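/- arXiv:math/0309153 — 3 statements merged into one kernel-verified Lean document; each statement's English description precedes it below -/
import Mathlib

section
/- There exists an absolute constant C > 0 such that for every integer n > 2 there exist constants A_n > 0 and c_n > 0 with the following property: for every number field K with fixed algebraic closure K̄ and every real X ≥ 1, the set of intermediate fields K ⊆ L ⊆ K̄ with [L:K] = n and Δ_{L/K} < X is finite, of cardinality at most c_n · (X · D_K^n · A_n^{[K:ℚ]})^{exp(C·√(log n))}. -/
open NumberField Module

/-- `Δ_{L/K}`: the absolute norm of the relative discriminant of `L/K`, computed as the
absolute norm of the different ideal of `𝓞_L` over `𝓞_K` (and junk value `0` if `L/K` is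
not finite). -/
noncomputable def relDiscNorm (K : Type*) [Field K] [NumberField K]
    {Kbar : Type*} [Field Kbar] [Algebra K Kbar]
    (L : IntermediateField K Kbar) : ℕ := by
  classical
  exact if h : FiniteDimensional K L then
    haveI : CharZero L := charZero_of_injective_algebraMap (algebraMap K L).injective
    haveI : FiniteDimensional ℚ L := Module.Finite.trans (R := ℚ) K L
    haveI : NumberField L :=
      { to_charZero := inferInstance, to_finiteDimensional := inferInstance }
    Ideal.absNorm (differentIdeal (𝓞 K) (𝓞 L))
  else 0

section part1
open MeasureTheory Metric ENNReal

theorem ev_card_le_of_separated {E : Type*} [NormedAddCommGroup E] [NormedSpace ℝ E]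
    [FiniteDimensional ℝ E] (s : Finset E) (R : ℝ) (hR : 0 ≤ R) (hs : ∀ c ∈ s, ‖c‖ ≤ R)
    (h : ∀ c ∈ s, ∀ d ∈ s, c ≠ d → 1 ≤ ‖c - d‖) :
    (s.card : ℝ) ≤ (2 * R + 1) ^ finrank ℝ E := by
  borelize E
  let μ : Measure E := Measure.addHaar
  let δ : ℝ := (1 : ℝ) / 2
  let ρ : ℝ := R + 1 / 2
  have ρpos : 0 < ρ := by positivity
  set A := ⋃ c ∈ s, ball (c : E) δ with hA
  have D : Set.Pairwise (s : Set E) (Function.onFun Disjoint fun c => ball (c : E) δ) := by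
    rintro c hc d hd hcd
    apply ball_disjoint_ball
    rw [dist_eq_norm]
    have := h c hc d hd hcd
    simp only [δ]; linarith
  have A_subset : A ⊆ ball (0 : E) ρ := by
    refine Set.iUnion₂_subset fun x hx => ?_
    apply ball_subset_ball'
    rw [dist_zero_right]
    have := hs x hx
    simp only [δ, ρ]; linarith
  have I :
    (s.card : ℝ≥0∞) * ENNReal.ofReal (δ ^ finrank ℝ E) * μ (ball 0 1) ≤
      ENNReal.ofReal (ρ ^ finrank ℝ E) * μ (ball 0 1) :=
    calc
      (s.card : ℝ≥0∞) * ENNReal.ofReal (δ ^ finrank ℝ E) * μ (ball 0 1) = μ A := by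
        rw [hA, measure_biUnion_finset D fun c _ => measurableSet_ball]
        have I : 0 < δ := by norm_num [δ]
        simp only [μ.addHaar_ball_of_pos _ I]
        simp only [Finset.sum_const, nsmul_eq_mul, mul_assoc]
      _ ≤ μ (ball (0 : E) ρ) := measure_mono A_subset
      _ = ENNReal.ofReal (ρ ^ finrank ℝ E) * μ (ball 0 1) := by
        simp only [μ.addHaar_ball_of_pos _ ρpos]
  have J : (s.card : ℝ≥0∞) * ENNReal.ofReal (δ ^ finrank ℝ E) ≤ ENNReal.ofReal (ρ ^ finrank ℝ E) :=
    (ENNReal.mul_le_mul_iff_left (measure_ball_pos _ _ zero_lt_one).ne' measure_ball_lt_top.ne).1 I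
  have := ENNReal.toReal_le_of_le_ofReal (pow_nonneg ρpos.le _) J
  rw [ENNReal.toReal_mul, ENNReal.toReal_natCast, ENNReal.toReal_ofReal (by positivity)] at this
  have e : (2 * R + 1) = 2 * ρ := by simp only [ρ]; ring
  rw [e, mul_pow]
  have h2 : δ ^ finrank ℝ E * 2 ^ finrank ℝ E = 1 := by rw [← mul_pow]; norm_num [δ]
  calc (s.card : ℝ) = (s.card * δ ^ finrank ℝ E) * 2 ^ finrank ℝ E := by rw [mul_assoc, h2, mul_one]
    _ ≤ ρ ^ finrank ℝ E * 2 ^ finrank ℝ E := by gcongr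
    _ = _ := by ring

/-- Packing: few small integers in a rational subspace. -/
theorem ev_card_small_le (L : Type*) [Field L] [NumberField L] (V : Submodule ℚ L)
    (s : Finset L) (R : ℝ) (hR : 0 ≤ R) (hsV : ∀ x ∈ s, x ∈ V) (hsint : ∀ x ∈ s, IsIntegral ℤ x)
    (hs : ∀ x ∈ s, house x ≤ R) : (s.card : ℝ) ≤ (2 * R + 1) ^ finrank ℚ V := by
  classical
  let b := Module.finBasis ℚ V
  let c : L →ₗ[ℚ] ((L →+* ℂ) → ℂ) := (canonicalEmbedding L).toRatAlgHom.toLinearMap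
  let E : Submodule ℝ ((L →+* ℂ) → ℂ) := Submodule.span ℝ (Set.range fun i => c (b i))
  have hE : finrank ℝ E ≤ finrank ℚ V := by
    have := finrank_range_le_card (R := ℝ) (fun i => c (b i))
    simpa [Set.finrank] using this
  have hmem : ∀ x ∈ V, c x ∈ E := by
    intro x hx
    have h1 : x = ∑ i, b.repr ⟨x, hx⟩ i • (b i : L) := by
      calc x = ((∑ i, b.repr ⟨x, hx⟩ i • b i : V) : L) := by rw [b.sum_repr]
        _ = _ := by simp only [Submodule.coe_sum, Submodule.coe_smul]
    rw [h1, map_sum]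
    refine Submodule.sum_mem _ fun i _ => ?_
    rw [map_smul]
    have : (b.repr ⟨x, hx⟩ i) • c (b i) = ((b.repr ⟨x, hx⟩ i : ℚ) : ℝ) • c (b i) := by
      ext φ; simp [Rat.smul_def]
    rw [this]
    exact Submodule.smul_mem _ _ (Submodule.subset_span ⟨i, rfl⟩)
  have key := ev_card_le_of_separated (E := E) (s.attach.image fun x => ⟨c x.1, hmem _ (hsV _ x.2)⟩) R hR
    (by
      intro y hy
      simp only [Finset.mem_image, Finset.mem_attach, true_and] at hy
      obtain ⟨x, rfl⟩ := hy
      exact hs _ x.2)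
    (by
      intro y hy z hz hyz
      simp only [Finset.mem_image, Finset.mem_attach, true_and] at hy hz
      obtain ⟨x, rfl⟩ := hy
      obtain ⟨x', rfl⟩ := hz
      have hne : x.1 - x'.1 ≠ 0 := by
        intro h0
        apply hyz
        rw [sub_eq_zero] at h0
        simp [h0]
      have := one_le_house_of_isIntegral ((hsint _ x.2).sub (hsint _ x'.2)) hne
      refine this.trans (le_of_eq ?_)
      change ‖c (x.1 - x'.1)‖ = ‖c x.1 - c x'.1‖
      rw [map_sub])
  rw [Finset.card_image_of_injective, Finset.card_attach] at key
  · exact key.trans (pow_le_pow_right₀ (by linarith) hE)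
  · intro x y hxy
    simp only [Subtype.mk.injEq] at hxy
    exact Subtype.ext (canonicalEmbedding_injective L hxy)

end part1

section part2
open MeasureTheory Metric ENNReal NNReal mixedEmbedding InfinitePlace

open scoped Classical in
/-- Blichfeldt-type lower bound for the number of small integers. -/
theorem ev_le_card_small (L : Type*) [Field L] [NumberField L] (Y : ℝ≥0)
    (s : Finset L) (hs : ∀ x : L, IsIntegral ℤ x → house x ≤ 2 * Y → x ∈ s) :
    (Y : ℝ) ^ finrank ℚ L ≤ s.card * Real.sqrt ((discr L).natAbs : ℝ) := by
  set F := ZSpan.fundamentalDomain (latticeBasis L) with hF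
  set B := convexBodyLT L (fun _ => Y) with hB
  have fund := fundamentalDomain_integerLattice L
  have hBm : MeasurableSet B := by
    refine MeasurableSet.prod ?_ ?_
    · exact MeasurableSet.univ_pi fun _ => measurableSet_ball
    · exact MeasurableSet.univ_pi fun _ => measurableSet_ball
  have : VAddInvariantMeasure (mixedEmbedding.integerLattice L) (mixedSpace L) volume :=
    ⟨fun g t _ => measure_preimage_add volume (g : mixedSpace L) t⟩
  have hBn : ∀ z ∈ B, ∀ w, normAtPlace w z < Y := by
    intro z hz w
    simp only [hB, Set.mem_prod, Set.mem_pi, Set.mem_univ, true_imp_iff, mem_ball_zero_iff] at hz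
    rcases w.isReal_or_isComplex with hw | hw
    · rw [normAtPlace_apply_of_isReal hw]; exact hz.1 ⟨w, hw⟩
    · rw [normAtPlace_apply_of_isComplex hw]; exact hz.2 ⟨w, hw⟩
  have hpre : ∀ g : mixedEmbedding.integerLattice L, ∃ a : 𝓞 L, mixedEmbedding L (a : L) = g := by
    rintro ⟨g, hg⟩
    simpa using hg
  choose pre hpre using hpre
  have h1 : volume B ≤ s.card * volume F := by
    calc volume B = ∫⁻ x, B.indicator 1 x := by rw [lintegral_indicator_one hBm]
      _ = ∑' g : mixedEmbedding.integerLattice L, ∫⁻ x in F, B.indicator 1 (g +ᵥ x) :=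
          fund.lintegral_eq_tsum'' _
      _ = ∫⁻ x in F, ∑' g : mixedEmbedding.integerLattice L, B.indicator 1 (g +ᵥ x) := by
          rw [lintegral_tsum]
          intro g
          exact ((measurable_one.indicator hBm).comp (measurable_const_vadd g)).aemeasurable
      _ ≤ ∫⁻ x in F, (s.card : ℝ≥0∞) := by
          refine lintegral_mono fun x => ?_
          have e : (fun g : mixedEmbedding.integerLattice L =>
              B.indicator (1 : mixedSpace L → ℝ≥0∞) (g +ᵥ x)) =
            ({g : mixedEmbedding.integerLattice L | g +ᵥ x ∈ B}).indicator 1 := by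
            ext g; simp [Set.indicator]
          rw [e, ← tsum_subtype]
          simp only [Pi.one_apply, ENNReal.tsum_set_one]
          have : ({g : mixedEmbedding.integerLattice L | g +ᵥ x ∈ B}).encard ≤ s.card := by
            rcases Set.eq_empty_or_nonempty {g : mixedEmbedding.integerLattice L | g +ᵥ x ∈ B}
              with h0 | ⟨g0, hg0⟩
            · simp [h0]
            rw [← Set.encard_coe_eq_coe_finsetCard]
            refine Set.encard_le_encard_of_injOn (f := fun g => ((pre g : L) - (pre g0 : L))) ?_ ?_
            · intro g hg
              refine hs _ ((pre g).isIntegral_coe.sub (pre g0).isIntegral_coe) ?_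
              change ‖canonicalEmbedding L _‖ ≤ _
              rw [canonicalEmbedding.norm_le_iff]
              intro φ
              have h2 : mixedEmbedding L ((pre g : L) - (pre g0 : L)) = (g +ᵥ x) + -(g0 +ᵥ x) := by
                rw [map_sub, hpre, hpre]
                simp only [Submodule.vadd_def, vadd_eq_add]; abel
              have h3 := normAtPlace_add_le (InfinitePlace.mk φ) (g +ᵥ x) (-(g0 +ᵥ x))
              rw [← h2, normAtPlace_neg, normAtPlace_apply] at h3
              have h4 := hBn _ hg (InfinitePlace.mk φ)
              have h5 := hBn _ hg0 (InfinitePlace.mk φ)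
              rw [InfinitePlace.apply] at h3
              linarith
            · intro g _ g' _ hgg
              simp only [sub_left_inj] at hgg
              apply Subtype.ext
              rw [← hpre, ← hpre, hgg]
          exact_mod_cast this
      _ = _ := by simp
  have h2 : (Y : ℝ≥0∞) ^ finrank ℚ L ≤ volume B := by
    rw [hB, convexBodyLT_volume, Finset.prod_pow_eq_pow_sum, sum_mult_eq]
    have h1' : (1 : ℝ≥0∞) ≤ (convexBodyLTFactor L : ℝ≥0∞) := by
      exact_mod_cast one_le_convexBodyLTFactor L
    calc (Y : ℝ≥0∞) ^ finrank ℚ L = 1 * (Y : ℝ≥0∞) ^ finrank ℚ L := (one_mul _).symm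
      _ ≤ (convexBodyLTFactor L : ℝ≥0∞) * (Y : ℝ≥0∞) ^ finrank ℚ L := by gcongr
      _ = _ := by push_cast; rfl
  have h3 : volume F ≤ (NNReal.sqrt ‖discr L‖₊ : ℝ≥0∞) := by
    rw [hF, volume_fundamentalDomain_latticeBasis]
    have h1' : (2 : ℝ≥0∞)⁻¹ ^ nrComplexPlaces L ≤ 1 := pow_le_one₀ (by simp) (by simp)
    calc (2 : ℝ≥0∞)⁻¹ ^ nrComplexPlaces L * (NNReal.sqrt ‖discr L‖₊ : ℝ≥0∞)
        ≤ 1 * (NNReal.sqrt ‖discr L‖₊ : ℝ≥0∞) := by gcongr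
      _ = _ := one_mul _
  have h4 : (Y : ℝ≥0∞) ^ finrank ℚ L ≤ s.card * (NNReal.sqrt ‖discr L‖₊ : ℝ≥0∞) :=
    h2.trans (h1.trans (by gcongr))
  have h5 : Y ^ finrank ℚ L ≤ s.card * NNReal.sqrt ‖discr L‖₊ := by exact_mod_cast h4
  have h6 : (Y : ℝ) ^ finrank ℚ L ≤ s.card * Real.sqrt ‖discr L‖ := by
    have := NNReal.coe_le_coe.2 h5
    simpa using this
  rwa [Int.norm_eq_abs, ← Int.cast_abs, Int.abs_eq_natAbs, Int.cast_natCast] at h6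
end part2

section part3
open scoped Pointwise

/-- The small integers span a large subspace. -/
theorem ev_span_large (L : Type*) [Field L] [NumberField L] (Y : ℝ) (hY : 1 ≤ Y)
    (hYD : 12 ^ finrank ℚ L * ((discr L).natAbs : ℝ) < Y ^ finrank ℚ L) :
    finrank ℚ L < 2 * finrank ℚ
      (Submodule.span ℚ {x : L | IsIntegral ℤ x ∧ house x ≤ Y}) := by
  classical
  have hfin : {x : L | IsIntegral ℤ x ∧ house x ≤ Y}.Finite := by
    refine (Embeddings.finite_of_norm_le L ℂ Y).subset ?_
    rintro x ⟨h1, h2⟩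
    exact ⟨h1, fun φ => (norm_embedding_le_house x φ).trans h2⟩
  set V := Submodule.span ℚ {x : L | IsIntegral ℤ x ∧ house x ≤ Y} with hV
  by_contra! hcon
  set N := finrank ℚ L
  set m := finrank ℚ V
  set D : ℝ := ((discr L).natAbs : ℝ)
  have hD : 0 ≤ D := by positivity
  have h1 := ev_card_small_le L V hfin.toFinset Y (by linarith)
    (fun x hx => Submodule.subset_span (by simpa using hx)) (fun x hx => by simp at hx; exact hx.1)
    (fun x hx => by simp at hx; exact hx.2)
  have h2 := ev_le_card_small L ⟨Y / 2, by linarith⟩ hfin.toFinset (by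
    intro x hx hx2
    simp only [Set.Finite.mem_toFinset, Set.mem_ofPred_eq]
    refine ⟨hx, hx2.trans (le_of_eq ?_)⟩
    change 2 * (Y / 2) = Y
    ring)
  change (Y / 2) ^ N ≤ _ * Real.sqrt D at h2
  have h3 : (Y / 2) ^ N ≤ (3 * Y) ^ m * Real.sqrt D := by
    refine h2.trans ?_
    gcongr
    refine h1.trans ?_
    gcongr
    linarith
  have h4 : ((Y / 2) ^ N) ^ 2 ≤ (3 * Y) ^ N * D := by
    calc ((Y / 2) ^ N) ^ 2 ≤ ((3 * Y) ^ m * Real.sqrt D) ^ 2 := by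
          have : 0 ≤ (Y / 2) ^ N := by positivity
          gcongr
      _ = (3 * Y) ^ (2 * m) * D := by rw [mul_pow, Real.sq_sqrt hD, ← pow_mul, mul_comm m]
      _ ≤ _ := by
          gcongr
          linarith
  have h5 : Y ^ N * Y ^ N ≤ Y ^ N * (12 ^ N * D) := by
    have e : ((Y / 2) ^ N) ^ 2 * 4 ^ N = Y ^ N * Y ^ N := by
      rw [← pow_mul, mul_comm N 2, pow_mul, ← mul_pow, ← mul_pow]; congr 1; ring
    have e2 : (3 * Y) ^ N * D * 4 ^ N = Y ^ N * (12 ^ N * D) := by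
      rw [show (12 : ℝ) = 3 * 4 by norm_num]
      simp only [mul_pow]; ring
    rw [← e, ← e2]
    gcongr
  have h6 := le_of_mul_le_mul_left h5 (by positivity)
  linarith

/-- A subspace of dimension more than half has product set spanning everything. -/
theorem ev_mul_span (L : Type*) [Field L] [NumberField L] (s : Set L)
    (h : finrank ℚ L < 2 * finrank ℚ (Submodule.span ℚ s)) :
    Submodule.span ℚ (s * s) = ⊤ := by
  by_contra hne
  obtain ⟨f, hf0, hf⟩ := Submodule.exists_le_ker_of_lt_top _ (lt_top_iff_ne_top.2 hne)
  set V := Submodule.span ℚ s with hV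
  let Φ : L →ₗ[ℚ] Dual ℚ L := (LinearMap.mul ℚ L).compr₂ f
  have hΦ : ∀ v w, Φ v w = f (v * w) := fun v w => rfl
  have hinj : Function.Injective Φ := by
    rw [injective_iff_map_eq_zero]
    intro v hv
    by_contra hv0
    apply hf0
    ext w
    have := congrArg (fun g => g (v⁻¹ * w)) hv
    simpa [hΦ, mul_inv_cancel_left₀ hv0] using this
  have hann : ∀ v ∈ V, Φ v ∈ V.dualAnnihilator := by
    intro v hv
    rw [Submodule.mem_dualAnnihilator]
    intro w hw
    rw [hΦ]
    have : v * w ∈ Submodule.span ℚ (s * s) := by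
      rw [← Submodule.span_mul_span]
      exact Submodule.mul_mem_mul hv hw
    exact hf this
  have h1 := LinearMap.finrank_le_finrank_of_injective (f := (Φ.restrict hann))
    (by
      intro x y hxy
      exact Subtype.ext (hinj (congrArg Subtype.val hxy)))
  have h2 := Subspace.finrank_add_finrank_dualAnnihilator_eq V
  omega

theorem ev_small_basis (K L : Type*) [Field K] [NumberField K] [Field L] [NumberField L]
    [Algebra K L] (n : ℕ) (hn : finrank K L = n) (Y : ℝ) (hY : 1 ≤ Y)
    (hYD : 12 ^ finrank ℚ L * ((discr L).natAbs : ℝ) < Y ^ finrank ℚ L) :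
    ∃ w : Basis (Fin n) K L, ∀ i, IsIntegral ℤ (w i) ∧ house (w i) ≤ Y ^ 2 := by
  classical
  set s := {x : L | IsIntegral ℤ x ∧ house x ≤ Y}
  have h1 := ev_mul_span L s (ev_span_large L Y hY hYD)
  have h2 : ⊤ ≤ Submodule.span K (s * s) := by
    intro x _
    have : x ∈ Submodule.span ℚ (s * s) := by rw [h1]; trivial
    exact Submodule.span_le_restrictScalars ℚ K (s * s) this
  let b := Basis.ofSpan h2
  have : Fintype (Set.range b) := inferInstance
  let e : _ ≃ Fin n := Fintype.equivFinOfCardEq ((Module.finrank_eq_card_basis b).symm.trans hn)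
  refine ⟨b.reindex e, fun i => ?_⟩
  have hb : b.reindex e i ∈ s * s := by
    rw [Basis.reindex_apply]
    exact Basis.ofSpan_subset h2 ⟨_, rfl⟩
  obtain ⟨x, hx, y, hy, hxy⟩ := hb
  simp only at hxy
  rw [← hxy]
  refine ⟨hx.1.mul hy.1, (house_mul_le x y).trans ?_⟩
  rw [sq]
  exact mul_le_mul hx.2 hy.2 (house_nonneg _) (by linarith)
end part3

section part4
open MvPolynomial

theorem ev_generic (K L : Type*) [Field K] [CharZero K] [Field L] [Algebra K L]
    [FiniteDimensional K L] (n r S : ℕ) (hn : finrank K L = n) (hS : n ≤ S ^ r)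
    (w : Basis (Fin n) K L) :
    ∃ t : Fin r → Fin n → ℕ, (∀ k i, t k i ≤ n * (r * S)) ∧
      Submodule.span K (Set.range fun a : Fin r → Fin S =>
        ∏ k, (∑ i, (t k i : L) * w i) ^ (a k : ℕ)) = ⊤ := by
  classical
  let E := AlgebraicClosure K
  have : CharZero E := charZero_of_injective_algebraMap (algebraMap K E).injective
  let σ : Fin n ≃ (L →ₐ[K] E) :=
    (Fintype.equivFinOfCardEq ((AlgHom.card K L E).trans hn)).symm
  let dig : Fin n → Fin r → Fin S := fun j => finFunctionFinEquiv.symm (Fin.castLE hS j)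
  have hdig : ∀ j, ∑ k : Fin r, (dig j k : ℕ) * S ^ (k : ℕ) = j := by
    intro j
    rw [← finFunctionFinEquiv_apply]
    simp [dig]
  let lin : Fin n → Fin r → MvPolynomial (Fin r × Fin n) E :=
    fun j k => ∑ i, C (σ j (w i)) * X (k, i)
  let M : Matrix (Fin n) (Fin n) (MvPolynomial (Fin r × Fin n) E) :=
    Matrix.of fun j0 j => ∏ k, lin j0 k ^ (dig j k : ℕ)
  let xx : (Fin r × Fin n → K) → Fin r → L := fun u k => ∑ i, u (k, i) • w i
  have heval : ∀ u : Fin r × Fin n → K, eval (fun p => algebraMap K E (u p)) M.det =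
      (Matrix.of fun j0 j => σ j0 (∏ k, xx u k ^ (dig j k : ℕ))).det := by
    intro u
    rw [RingHom.map_det]
    congr 1
    ext j0 j
    simp only [RingHom.mapMatrix_apply, Matrix.map_apply, M, Matrix.of_apply, map_prod, map_pow,
      lin, map_sum, map_mul, eval_C, eval_X, xx, Algebra.smul_def]
    simp only [AlgHom.commutes, mul_comm]
  -- nonvanishing
  have hP : M.det ≠ 0 := by
    intro h0
    let pb := Field.powerBasisOfFiniteOfSeparable K L
    let u : Fin r × Fin n → K := fun p => w.repr (pb.gen ^ (S ^ (p.1 : ℕ))) p.2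
    have hx : ∀ k, xx u k = pb.gen ^ (S ^ (k : ℕ)) := fun k =>
      w.sum_repr (pb.gen ^ (S ^ (k : ℕ)))
    have h1 := heval u
    rw [h0, map_zero] at h1
    have h2 : (Matrix.of fun j0 j => σ j0 (∏ k, xx u k ^ (dig j k : ℕ))) =
        Matrix.vandermonde (fun j0 => σ j0 pb.gen) := by
      ext j0 j
      simp only [Matrix.of_apply, hx, Matrix.vandermonde_apply, ← map_pow, ← pow_mul]
      rw [Finset.prod_pow_eq_pow_sum]
      congr 2
      rw [← hdig j]
      exact Finset.sum_congr rfl fun k _ => mul_comm _ _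
    rw [h2] at h1
    refine Matrix.det_vandermonde_ne_zero_iff.2 ?_ h1.symm
    intro a b hab
    exact σ.injective (pb.algHom_ext hab)
  -- degree
  have hdeg : M.det.totalDegree ≤ n * (r * S) := by
    have hlin : ∀ j k, (lin j k).totalDegree ≤ 1 := by
      intro j k
      refine totalDegree_finsetSum_le fun i _ => ?_
      refine (totalDegree_mul _ _).trans ?_
      simp
    have hent : ∀ j0 j, (M j0 j).totalDegree ≤ r * S := by
      intro j0 j
      change (∏ k, lin j0 k ^ (dig j k : ℕ)).totalDegree ≤ _
      refine (totalDegree_finsetProd _ _).trans ?_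
      calc _ ≤ ∑ k : Fin r, S := by
            refine Finset.sum_le_sum fun k _ => (totalDegree_pow _ _).trans ?_
            calc _ ≤ (dig j k : ℕ) * 1 := Nat.mul_le_mul_left _ (hlin _ _)
              _ ≤ S := by simpa using (dig j k).2.le
        _ = _ := by simp
    rw [Matrix.det_apply]
    refine totalDegree_finsetSum_le fun τ _ => ?_
    refine (totalDegree_smul_le _ _).trans ((totalDegree_finsetProd _ _).trans ?_)
    calc _ ≤ ∑ k : Fin n, r * S := Finset.sum_le_sum fun k _ => hent _ _
      _ = _ := by simp
  let T : Finset E := (Finset.range (n * (r * S) + 1)).image (fun m : ℕ => (m : E))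
  have hT : T.card = n * (r * S) + 1 := by
    rw [Finset.card_image_of_injective _ Nat.cast_injective, Finset.card_range]
  have : ∃ y : Fin r × Fin n → E, (∀ p, y p ∈ T) ∧ eval y M.det ≠ 0 := by
    by_contra! hcon
    refine hP (eq_zero_of_eval_zero_at_prod_finset _ (fun _ => T) (fun p => ?_) hcon)
    rw [hT]
    exact Nat.lt_succ_of_le ((degreeOf_le_totalDegree _ _).trans hdeg)
  obtain ⟨y, hyT, hy⟩ := this
  have : ∀ p, ∃ m : ℕ, m ≤ n * (r * S) ∧ (m : E) = y p := by
    intro p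
    obtain ⟨m, hm, hm2⟩ := Finset.mem_image.1 (hyT p)
    exact ⟨m, Nat.lt_succ_iff.1 (Finset.mem_range.1 hm), hm2⟩
  choose t ht hty using this
  refine ⟨fun k i => t (k, i), fun k i => ht _, ?_⟩
  let u : Fin r × Fin n → K := fun p => (t p : K)
  have hu : (fun p => algebraMap K E (u p)) = y := by
    ext p; simp [u, hty]
  rw [← hu, heval] at hy
  have hx : ∀ k, xx u k = ∑ i, (t (k, i) : L) * w i := by
    intro k; simp [xx, u, Algebra.smul_def]
  have hli : LinearIndependent K (fun j => ∏ k, xx u k ^ (dig j k : ℕ)) := by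
    rw [Fintype.linearIndependent_iff]
    intro g hg
    have h1 : (Matrix.of fun j0 j => σ j0 (∏ k, xx u k ^ (dig j k : ℕ))).mulVec
        (fun j => algebraMap K E (g j)) = 0 := by
      ext j0
      have := congrArg (σ j0) hg
      simp only [map_sum, map_zero, Algebra.smul_def] at this
      simp only [Matrix.mulVec, dotProduct, Matrix.of_apply, Pi.zero_apply]
      rw [← this]
      exact Finset.sum_congr rfl fun j _ => by rw [map_mul, AlgHom.commutes, mul_comm]
    have h2 := Matrix.eq_zero_of_mulVec_eq_zero hy h1
    intro j
    have := congrFun h2 j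
    simpa using this
  have htop := hli.span_eq_top_of_card_eq_finrank' (by simp [hn])
  rw [eq_top_iff, ← htop]
  refine Submodule.span_mono ?_
  rintro _ ⟨j, rfl⟩
  refine ⟨dig j, ?_⟩
  simp only [hx]
end part4

section part5
open MvPolynomial

/-- If traces of monomials agree then polynomial relations transfer. -/
theorem ev_transfer (K L L' : Type*) [Field K] [CharZero K] [Field L] [Algebra K L]
    [FiniteDimensional K L] [Field L'] [Algebra K L'] [FiniteDimensional K L'] (r S : ℕ)
    (hS0 : 0 < S) (x : Fin r → L) (x' : Fin r → L')
    (hx : Submodule.span K (Set.range fun a : Fin r → Fin S => ∏ k, x k ^ (a k : ℕ)) = ⊤)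
    (hx' : Submodule.span K (Set.range fun a : Fin r → Fin S => ∏ k, x' k ^ (a k : ℕ)) = ⊤)
    (htr : ∀ a : Fin r → Fin (2 * S), Algebra.trace K L (∏ k, x k ^ (a k : ℕ)) =
      Algebra.trace K L' (∏ k, x' k ^ (a k : ℕ))) :
    RingHom.ker (aeval x : MvPolynomial (Fin r) K →ₐ[K] L) ≤
      RingHom.ker (aeval x' : MvPolynomial (Fin r) K →ₐ[K] L') := by
  classical
  set π : MvPolynomial (Fin r) K →ₐ[K] L := aeval x with hπ
  set π' : MvPolynomial (Fin r) K →ₐ[K] L' := aeval x' with hπ'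
  let mon : (Fin r → ℕ) → MvPolynomial (Fin r) K := fun a => ∏ k, X k ^ (a k)
  have hmon : ∀ a, π (mon a) = ∏ k, x k ^ a k := by intro a; simp [mon, hπ]
  have hmon' : ∀ a, π' (mon a) = ∏ k, x' k ^ a k := by intro a; simp [mon, hπ']
  let M : Submodule K (MvPolynomial (Fin r) K) :=
    Submodule.span K (Set.range fun a : Fin r → Fin S => mon (fun k => a k))
  have hMtop : M.map π.toLinearMap = ⊤ := by
    rw [← hx, Submodule.map_span, ← Set.range_comp]
    congr 2
    ext a
    exact hmon _
  have hMtop' : M.map π'.toLinearMap = ⊤ := by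
    rw [← hx', Submodule.map_span, ← Set.range_comp]
    congr 2
    ext a
    exact hmon' _
  have hsurj : ∀ y : L, ∃ h ∈ M, π h = y := by
    intro y
    have : y ∈ M.map π.toLinearMap := by rw [hMtop]; trivial
    obtain ⟨h, h1, h2⟩ := this
    exact ⟨h, h1, h2⟩
  have hsurj' : ∀ y : L', ∃ h ∈ M, π' h = y := by
    intro y
    have : y ∈ M.map π'.toLinearMap := by rw [hMtop']; trivial
    obtain ⟨h, h1, h2⟩ := this
    exact ⟨h, h1, h2⟩
  let τ : MvPolynomial (Fin r) K →ₗ[K] K := (Algebra.trace K L).comp π.toLinearMap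
  let τ' : MvPolynomial (Fin r) K →ₗ[K] K := (Algebra.trace K L').comp π'.toLinearMap
  have hτ : ∀ f, τ f = Algebra.trace K L (π f) := fun _ => rfl
  have hτ' : ∀ f, τ' f = Algebra.trace K L' (π' f) := fun _ => rfl
  have hmonτ : ∀ a : Fin r → ℕ, (∀ k, a k < 2 * S) → τ (mon a) = τ' (mon a) := by
    intro a ha
    rw [hτ, hτ', hmon, hmon']
    exact htr (fun k => ⟨a k, ha k⟩)
  have hmul : ∀ a b : Fin r → ℕ, mon a * mon b = mon (a + b) := by
    intro a b; simp [mon, pow_add, Finset.prod_mul_distrib]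
  have hX : ∀ k, (X k : MvPolynomial (Fin r) K) = mon (Pi.single k 1) := by
    intro k
    simp only [mon]
    rw [Finset.prod_eq_single k]
    · simp
    · intro b _ hb; simp [hb]
    · simp
  -- equality of traces on products
  have hq : ∀ q : MvPolynomial (Fin r) K,
      (∀ a b : Fin r → Fin S, τ (q * (mon (fun k => a k) * mon (fun k => b k))) =
        τ' (q * (mon (fun k => a k) * mon (fun k => b k)))) →
      ∀ f ∈ M, ∀ g ∈ M, τ (q * (f * g)) = τ' (q * (f * g)) := by
    intro q h f hf g hg
    induction hf using Submodule.span_induction with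
    | mem f hf =>
      obtain ⟨a, rfl⟩ := hf
      induction hg using Submodule.span_induction with
      | mem g hg => obtain ⟨b, rfl⟩ := hg; exact h a b
      | zero => simp
      | add u v _ _ hu hv => simp only [mul_add, map_add, hu, hv]
      | smul c u _ hu => simp only [mul_smul_comm, map_smul, hu]
    | zero => simp
    | add u v _ _ hu hv => simp only [mul_add, add_mul, map_add, hu, hv]
    | smul c u _ hu => simp only [mul_smul_comm, smul_mul_assoc, map_smul, hu]
  have hq1 : ∀ f ∈ M, ∀ g ∈ M, τ (f * g) = τ' (f * g) := by
    have := hq 1 (by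
      intro a b
      rw [one_mul, hmul]
      apply hmonτ
      intro k
      have h1 := (a k).2
      have h2 := (b k).2
      simp only [Pi.add_apply]; omega)
    simpa only [one_mul] using this
  have hqX : ∀ k, ∀ f ∈ M, ∀ g ∈ M, τ (X k * (f * g)) = τ' (X k * (f * g)) := by
    intro k
    apply hq
    intro a b
    rw [hmul, hX, hmul]
    apply hmonτ
    intro l
    have h1 := (a l).2
    have h2 := (b l).2
    have h3 : (Pi.single k 1 : Fin r → ℕ) l ≤ 1 := by
      by_cases h : l = k
      · subst h; simp
      · simp [h]
    simp only [Pi.add_apply]; omega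
  -- nondegeneracy
  have hnd' : ∀ y : L', (∀ g ∈ M, Algebra.trace K L' (y * π' g) = 0) → y = 0 := by
    intro y hy
    refine (traceForm_nondegenerate K L').1 y fun z => ?_
    obtain ⟨g, hg, rfl⟩ := hsurj' z
    exact hy g hg
  have hker : ∀ f ∈ M, π f = 0 → π' f = 0 := by
    intro f hf h0
    apply hnd'
    intro g hg
    rw [← map_mul, ← hτ', ← hq1 f hf g hg, hτ, map_mul, h0, zero_mul, map_zero]
  have h1M : ∀ c : K, C c ∈ M := by
    intro c
    have : (C c : MvPolynomial (Fin r) K) = c • mon (fun k => ((fun _ => ⟨0, hS0⟩ : Fin r → Fin S) k : ℕ)) := by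
      simp [mon, MvPolynomial.smul_eq_C_mul]
    rw [this]
    exact M.smul_mem _ (Submodule.subset_span ⟨_, rfl⟩)
  have hred : ∀ f : MvPolynomial (Fin r) K, ∃ h ∈ M, π f = π h ∧ π' f = π' h := by
    intro f
    induction f using MvPolynomial.induction_on with
    | C c => exact ⟨C c, h1M c, rfl, rfl⟩
    | add p q hp hq =>
      obtain ⟨h1, hm1, e1, e1'⟩ := hp
      obtain ⟨h2, hm2, e2, e2'⟩ := hq
      exact ⟨h1 + h2, M.add_mem hm1 hm2, by simp [e1, e2], by simp [e1', e2']⟩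
    | mul_X p k hp =>
      obtain ⟨h1, hm1, e1, e1'⟩ := hp
      obtain ⟨h, hm, e⟩ := hsurj (π (p * X k))
      refine ⟨h, hm, e.symm, ?_⟩
      rw [← sub_eq_zero]
      apply hnd'
      intro g hg
      have hA : Algebra.trace K L' (π' h * π' g) = Algebra.trace K L (π h * π g) := by
        rw [← map_mul, ← hτ', ← hq1 h hm g hg, hτ, map_mul]
      rw [sub_mul, map_sub, sub_eq_zero, hA, e, map_mul π p (X k), e1, map_mul π' p (X k), e1']
      have := hqX k h1 hm1 g hg
      rw [hτ, hτ'] at this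
      simp only [map_mul] at this
      rw [show π h1 * π (X k) * π g = π (X k) * (π h1 * π g) by ring,
        show π' h1 * π' (X k) * π' g = π' (X k) * (π' h1 * π' g) by ring, this]
  intro f hf
  rw [RingHom.mem_ker] at hf ⊢
  obtain ⟨h, hm, e, e'⟩ := hred f
  rw [show π' f = π' h from e']
  exact hker h hm (e.symm.trans hf)

theorem ev_aeval_surj (K L : Type*) [Field K] [Field L] [Algebra K L] (r S : ℕ) (x : Fin r → L)
    (hx : Submodule.span K (Set.range fun a : Fin r → Fin S => ∏ k, x k ^ (a k : ℕ)) = ⊤) :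
    Function.Surjective (aeval x : MvPolynomial (Fin r) K →ₐ[K] L) := by
  intro y
  have hy : y ∈ Submodule.span K (Set.range fun a : Fin r → Fin S => ∏ k, x k ^ (a k : ℕ)) := by
    rw [hx]; trivial
  induction hy using Submodule.span_induction with
  | mem f hf =>
    obtain ⟨a, rfl⟩ := hf
    exact ⟨∏ k, X k ^ (a k : ℕ), by simp⟩
  | zero => exact ⟨0, map_zero _⟩
  | add u v _ _ hu hv =>
    obtain ⟨a, rfl⟩ := hu
    obtain ⟨b, rfl⟩ := hv
    exact ⟨a + b, map_add _ _ _⟩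
  | smul c u _ hu =>
    obtain ⟨a, rfl⟩ := hu
    exact ⟨c • a, map_smul _ _ _⟩

theorem ev_iso (K L L' : Type*) [Field K] [CharZero K] [Field L] [Algebra K L]
    [FiniteDimensional K L] [Field L'] [Algebra K L'] [FiniteDimensional K L'] (r S : ℕ)
    (hS0 : 0 < S) (x : Fin r → L) (x' : Fin r → L')
    (hx : Submodule.span K (Set.range fun a : Fin r → Fin S => ∏ k, x k ^ (a k : ℕ)) = ⊤)
    (hx' : Submodule.span K (Set.range fun a : Fin r → Fin S => ∏ k, x' k ^ (a k : ℕ)) = ⊤)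
    (htr : ∀ a : Fin r → Fin (2 * S), Algebra.trace K L (∏ k, x k ^ (a k : ℕ)) =
      Algebra.trace K L' (∏ k, x' k ^ (a k : ℕ))) : Nonempty (L ≃ₐ[K] L') := by
  have h := le_antisymm (ev_transfer K L L' r S hS0 x x' hx hx' htr)
    (ev_transfer K L' L r S hS0 x' x hx' hx (fun a => (htr a).symm))
  exact ⟨(Ideal.quotientKerAlgEquivOfSurjective (ev_aeval_surj K L r S x hx)).symm.trans
    ((Ideal.quotientEquivAlgOfEq K h).trans
      (Ideal.quotientKerAlgEquivOfSurjective (ev_aeval_surj K L' r S x' hx')))⟩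

/-- The house of a trace. -/
theorem ev_house_trace (K L : Type*) [Field K] [NumberField K] [Field L] [NumberField L]
    [Algebra K L] (x : L) : house (Algebra.trace K L x) ≤ finrank K L * house x := by
  change ‖canonicalEmbedding K _‖ ≤ _
  rw [canonicalEmbedding.norm_le_iff]
  intro ψ
  letI : Algebra K ℂ := ψ.toAlgebra
  have h := trace_eq_sum_embeddings (K := K) (L := L) ℂ (x := x)
  change ψ _ = _ at h
  rw [h]
  refine (norm_sum_le _ _).trans ?_
  calc _ ≤ ∑ σ : L →ₐ[K] ℂ, house x :=
        Finset.sum_le_sum fun σ _ => norm_embedding_le_house x σ.toRingHom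
    _ = _ := by simp [AlgHom.card K L ℂ]
end part5

section part6

/-- Every extension has a short code. -/
theorem ev_code (K L : Type*) [Field K] [NumberField K] [Field L] [NumberField L] [Algebra K L]
    (n r S : ℕ) (hn0 : 0 < n) (hr0 : 0 < r) (hS0 : 0 < S)
    (hn : finrank K L = n) (hS : n ≤ S ^ r) (Y : ℝ) (hY : 1 ≤ Y)
    (hYD : 12 ^ finrank ℚ L * ((discr L).natAbs : ℝ) < Y ^ finrank ℚ L) :
    ∃ x : Fin r → L,
      Submodule.span K (Set.range fun a : Fin r → Fin S => ∏ k, x k ^ (a k : ℕ)) = ⊤ ∧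
      ∀ a : Fin r → Fin (2 * S), IsIntegral ℤ (Algebra.trace K L (∏ k, x k ^ (a k : ℕ))) ∧
        house (Algebra.trace K L (∏ k, x k ^ (a k : ℕ))) ≤
          n * (((n * (n * (r * S)) : ℕ) : ℝ) * Y ^ 2) ^ (2 * S * r) := by
  obtain ⟨w, hw⟩ := ev_small_basis K L n hn Y hY hYD
  obtain ⟨t, ht, hsp⟩ := ev_generic K L n r S hn hS w
  refine ⟨fun k => ∑ i, (t k i : L) * w i, hsp, ?_⟩
  set x : Fin r → L := fun k => ∑ i, (t k i : L) * w i with hx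
  set R : ℝ := ((n * (n * (r * S)) : ℕ) : ℝ) * Y ^ 2 with hR
  have hR1 : 1 ≤ R := by
    have h1 : (1 : ℝ) ≤ ((n * (n * (r * S)) : ℕ) : ℝ) := by
      exact_mod_cast Nat.succ_le_of_lt (by positivity : 0 < n * (n * (r * S)))
    have h2 : (1 : ℝ) ≤ Y ^ 2 := one_le_pow₀ hY
    nlinarith
  have hxint : ∀ k, IsIntegral ℤ (x k) := by
    intro k
    refine IsIntegral.sum _ fun i _ => ?_
    refine IsIntegral.mul (R := ℤ) (A := L) ?_ (hw i).1
    simpa using isIntegral_algebraMap (R := ℤ) (A := L) (x := (t k i : ℤ))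
  have hxh : ∀ k, house (x k) ≤ R := by
    intro k
    refine (house_sum_le_sum_house _ _).trans ?_
    calc ∑ i, house ((t k i : L) * w i) ≤ ∑ i : Fin n, ((n * (r * S) : ℕ) : ℝ) * Y ^ 2 := by
          refine Finset.sum_le_sum fun i _ => ?_
          rw [house_nat_mul]
          refine mul_le_mul (by exact_mod_cast ht k i) (hw i).2 (house_nonneg _) (by positivity)
      _ = R := by rw [hR]; simp; ring
  intro a
  constructor
  · apply Algebra.isIntegral_trace
    exact IsIntegral.prod _ fun k _ => (hxint k).pow _
  · refine (ev_house_trace K L _).trans ?_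
    rw [hn]
    refine mul_le_mul_of_nonneg_left ?_ (by positivity)
    change ‖canonicalEmbedding L _‖ ≤ _
    rw [canonicalEmbedding.norm_le_iff]
    intro ψ
    rw [map_prod, norm_prod]
    calc ∏ k, ‖ψ (x k ^ (a k : ℕ))‖ ≤ ∏ k : Fin r, R ^ (2 * S) := by
          refine Finset.prod_le_prod (fun _ _ => norm_nonneg _) fun k _ => ?_
          rw [map_pow, norm_pow]
          exact (pow_le_pow_left₀ (norm_nonneg _)
            ((norm_embedding_le_house _ ψ).trans (hxh k)) _).trans
            (pow_le_pow_right₀ hR1 (a k).2.le)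
      _ = R ^ (2 * S * r) := by rw [Finset.prod_const, Finset.card_univ, Fintype.card_fin, ← pow_mul]

/-- Counting extensions through their codes. -/
theorem ev_count (K Kbar : Type*) [Field K] [CharZero K] [Field Kbar] [Algebra K Kbar]
    [IsAlgClosed Kbar] (n r S : ℕ) (hn0 : 0 < n) (hS0 : 0 < S) (H : Finset K)
    (F : Set (IntermediateField K Kbar))
    (hF : ∀ L ∈ F, finrank K L = n ∧ ∃ x : Fin r → L,
      Submodule.span K (Set.range fun a : Fin r → Fin S => ∏ k, x k ^ (a k : ℕ)) = ⊤ ∧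
      ∀ a : Fin r → Fin (2 * S), Algebra.trace K L (∏ k, x k ^ (a k : ℕ)) ∈ H) :
    F.Finite ∧ Nat.card F ≤ n * H.card ^ ((2 * S) ^ r) := by
  classical
  choose hfin x hsp hH using hF
  let f : F → ((Fin r → Fin (2 * S)) → H) := fun L a => ⟨_, hH L.1 L.2 a⟩
  have key : ∀ s : Finset F, s.card ≤ n * H.card ^ ((2 * S) ^ r) := by
    intro s
    have h1 := Finset.card_le_mul_card_image (f := f) s n (by
      intro b hb
      obtain ⟨L0, hL0, rfl⟩ := Finset.mem_image.1 hb
      haveI : FiniteDimensional K L0.1 :=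
        FiniteDimensional.of_finrank_pos (by rw [hfin L0.1 L0.2]; exact hn0)
      rw [← hfin L0.1 L0.2, ← AlgHom.card K L0.1 Kbar, ← Finset.card_univ]
      refine (Finset.card_le_card_of_injOn (t := Finset.univ.image
        (fun σ : L0.1 →ₐ[K] Kbar => σ.fieldRange)) (fun L => L.1) ?_ ?_).trans
        Finset.card_image_le
      · intro L hL
        have hL2 : f L = f L0 := (Finset.mem_filter.1 hL).2
        haveI : FiniteDimensional K L.1 :=
          FiniteDimensional.of_finrank_pos (by rw [hfin L.1 L.2]; exact hn0)
        obtain ⟨e⟩ := ev_iso K L0.1 L.1 r S hS0 (x L0.1 L0.2) (x L.1 L.2) (hsp _ _) (hsp _ _) (by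
          intro a
          exact (congrArg Subtype.val (congrFun hL2 a)).symm)
        refine Finset.mem_coe.2 (Finset.mem_image.2 ⟨L.1.val.comp e.toAlgHom, Finset.mem_univ _, ?_⟩)
        ext y
        constructor
        · rintro ⟨z, rfl⟩
          exact (e z).2
        · intro hy
          exact ⟨e.symm ⟨y, hy⟩, by simp⟩
      · intro a _ b _ h
        exact Subtype.ext h)
    refine h1.trans (Nat.mul_le_mul_left _ ?_)
    refine (Finset.card_le_univ _).trans ?_
    simp
  have hfinite : Finite F := by
    by_contra h
    rw [not_finite_iff_infinite] at h
    obtain ⟨s, hs⟩ := Infinite.exists_subset_card_eq F (n * H.card ^ ((2 * S) ^ r) + 1)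
    have := key s
    omega
  refine ⟨Set.toFinite F, ?_⟩
  haveI := Fintype.ofFinite F
  rw [Nat.card_eq_fintype_card, ← Finset.card_univ]
  exact key _

theorem ev_smallset (K : Type*) [Field K] [NumberField K] (Z : ℝ) (hZ : 0 ≤ Z) :
    ∃ H : Finset K, (∀ y : K, IsIntegral ℤ y → house y ≤ Z → y ∈ H) ∧
      (H.card : ℝ) ≤ (2 * Z + 1) ^ finrank ℚ K := by
  have hfin := Embeddings.finite_of_norm_le K ℂ Z
  refine ⟨hfin.toFinset, ?_, ?_⟩
  · intro y hy hyZ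
    rw [Set.Finite.mem_toFinset]
    exact ⟨hy, fun φ => (norm_embedding_le_house _ φ).trans hyZ⟩
  · have := ev_card_small_le K ⊤ hfin.toFinset Z hZ (fun _ _ => trivial)
      (fun y hy => ((Set.Finite.mem_toFinset _).1 hy).1)
      (fun y hy => by
        change ‖canonicalEmbedding K _‖ ≤ _
        rw [canonicalEmbedding.norm_le_iff]
        exact ((Set.Finite.mem_toFinset _).1 hy).2)
    rwa [finrank_top] at this

/-- The main counting bound, before numerics. -/
theorem ev_main (K Kbar : Type) [Field K] [NumberField K] [Field Kbar] [Algebra K Kbar]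
    [IsAlgClosure K Kbar] (n r S : ℕ) (hn0 : 0 < n) (hr0 : 0 < r) (hS0 : 0 < S) (hS : n ≤ S ^ r)
    (X Y Z : ℝ) (hY : 1 ≤ Y)
    (hYX : 12 ^ (n * finrank ℚ K) * (X * ((discr K).natAbs : ℝ) ^ n) ≤ Y ^ (n * finrank ℚ K))
    (hZ : Z = n * (((n * (n * (r * S)) : ℕ) : ℝ) * Y ^ 2) ^ (2 * S * r)) :
    {L : IntermediateField K Kbar | finrank K L = n ∧ (relDiscNorm K L : ℝ) < X}.Finite ∧
    (Nat.card {L : IntermediateField K Kbar | finrank K L = n ∧ (relDiscNorm K L : ℝ) < X} : ℝ) ≤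
      n * ((2 * Z + 1) ^ finrank ℚ K) ^ ((2 * S) ^ r) := by
  have hZ0 : 0 ≤ Z := by rw [hZ]; positivity
  haveI : IsAlgClosed Kbar := IsAlgClosure.isAlgClosed K
  obtain ⟨H, hH, hHc⟩ := ev_smallset K Z hZ0
  obtain ⟨h1, h2⟩ := ev_count K Kbar n r S hn0 hS0 H
    {L : IntermediateField K Kbar | finrank K L = n ∧ (relDiscNorm K L : ℝ) < X} (by
      rintro L ⟨hL, hLX⟩
      refine ⟨hL, ?_⟩
      have h : FiniteDimensional K L := FiniteDimensional.of_finrank_pos (by rw [hL]; exact hn0)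
      haveI : CharZero L := charZero_of_injective_algebraMap (algebraMap K L).injective
      haveI : FiniteDimensional ℚ L := Module.Finite.trans (R := ℚ) K L
      haveI : NumberField L :=
        { to_charZero := inferInstance, to_finiteDimensional := inferInstance }
      have hD : relDiscNorm K L = Ideal.absNorm (differentIdeal (𝓞 K) (𝓞 L)) := by
        unfold relDiscNorm
        exact dif_pos h
      have hdisc := natAbs_discr_eq_absNorm_differentIdeal_mul_natAbs_discr_pow K (𝓞 K) L (𝓞 L)
      rw [← hD, hL] at hdisc
      have hN : finrank ℚ L = n * finrank ℚ K := by
        rw [← hL, mul_comm]; exact (finrank_mul_finrank ℚ K L).symm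
      have hDK : (0 : ℝ) < ((discr K).natAbs : ℝ) := by
        exact_mod_cast Int.natAbs_pos.2 (discr_ne_zero K)
      obtain ⟨x, hx, hx2⟩ := ev_code K L n r S hn0 hr0 hS0 hL hS Y hY (by
        rw [hN, hdisc]
        refine lt_of_lt_of_le ?_ hYX
        push_cast
        gcongr)
      exact ⟨x, hx, fun a => hH _ (hx2 a).1 (hZ ▸ (hx2 a).2)⟩)
  refine ⟨h1, ?_⟩
  calc (Nat.card {L : IntermediateField K Kbar |
          finrank K L = n ∧ (relDiscNorm K L : ℝ) < X} : ℝ)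
      ≤ ((n * H.card ^ ((2 * S) ^ r) : ℕ) : ℝ) := by exact_mod_cast h2
    _ = n * (H.card : ℝ) ^ ((2 * S) ^ r) := by push_cast; ring
    _ ≤ _ := by gcongr
end part6

section part7

theorem ev_params (n : ℕ) (hn : 2 < n) : ∃ r S : ℕ, 0 < r ∧ 0 < S ∧ n ≤ S ^ r ∧
    ((2 * (2 * S * r) * (2 * S) ^ r : ℕ) : ℝ) ≤ n * Real.exp (10 * Real.sqrt (Real.log n)) := by
  set u : ℝ := Real.sqrt (Real.log n) with hu
  have hn3 : (3 : ℝ) ≤ n := by exact_mod_cast hn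
  have hn0 : (0 : ℝ) < n := by linarith
  have hlog : 1 ≤ Real.log n := by
    rw [Real.le_log_iff_exp_le hn0]
    linarith [Real.exp_one_lt_d9]
  have hu1 : 1 ≤ u := by rw [hu]; exact Real.one_le_sqrt.2 hlog
  have hu2 : u * u = Real.log n := Real.mul_self_sqrt (by linarith)
  have hnexp : (n : ℝ) = Real.exp (u * u) := by rw [hu2, Real.exp_log hn0]
  have he1 : 1 ≤ Real.exp u := Real.one_le_exp (by linarith)
  set r := ⌈u⌉₊ with hr
  set S := ⌈Real.exp u⌉₊ with hS
  have hr1 : u ≤ r := Nat.le_ceil u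
  have hr2 : (r : ℝ) ≤ u + 1 := (Nat.ceil_lt_add_one (by linarith)).le
  have hS1 : Real.exp u ≤ S := Nat.le_ceil _
  have hS2 : (S : ℝ) ≤ 2 * Real.exp u := by
    have := (Nat.ceil_lt_add_one (Real.exp_pos u).le).le
    linarith
  have hlog4 : Real.log 4 ≤ 1.4 := by
    rw [show (4 : ℝ) = 2 ^ 2 by norm_num, Real.log_pow]
    have := Real.log_two_lt_d9
    push_cast; linarith
  refine ⟨r, S, Nat.ceil_pos.2 (by linarith), Nat.ceil_pos.2 (Real.exp_pos _), ?_, ?_⟩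
  · have : (n : ℝ) ≤ (S : ℝ) ^ r := by
      calc (n : ℝ) = Real.exp (u * u) := hnexp
        _ ≤ Real.exp (r * u) := Real.exp_le_exp.2 (by nlinarith)
        _ = Real.exp u ^ r := Real.exp_nat_mul u r
        _ ≤ (S : ℝ) ^ r := by gcongr
    exact_mod_cast this
  · have h1 : (2 * (S : ℝ)) ^ r ≤ n * Real.exp (4 * u) := by
      calc (2 * (S : ℝ)) ^ r ≤ (4 * Real.exp u) ^ r := by
            apply pow_le_pow_left₀ (by positivity); linarith
        _ = Real.exp (Real.log 4 + u) ^ r := by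
            rw [Real.exp_add, Real.exp_log (by norm_num)]
        _ = Real.exp (r * (Real.log 4 + u)) := (Real.exp_nat_mul _ r).symm
        _ ≤ Real.exp (u * u + 4 * u) := by
            apply Real.exp_le_exp.2
            have : 0 ≤ Real.log 4 := Real.log_nonneg (by norm_num)
            nlinarith
        _ = _ := by rw [Real.exp_add, hnexp]
    have h2 : 2 * (2 * (S : ℝ) * r) ≤ Real.exp (6 * u) := by
      have h3 : (2 : ℝ) ≤ Real.exp u := by linarith [Real.add_one_le_exp u]
      have h4 : u ≤ Real.exp u := by linarith [Real.add_one_le_exp u]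
      have h5 : (16 : ℝ) ≤ Real.exp u ^ 4 := by
        calc (16 : ℝ) = 2 ^ 4 := by norm_num
          _ ≤ _ := by gcongr
      calc 2 * (2 * (S : ℝ) * r) ≤ 2 * (2 * (2 * Real.exp u) * (2 * u)) := by
            gcongr; linarith
        _ = 16 * (Real.exp u * u) := by ring
        _ ≤ Real.exp u ^ 4 * (Real.exp u * Real.exp u) := by gcongr
        _ = Real.exp u ^ 6 := by ring
        _ = Real.exp (6 * u) := by
            have := Real.exp_nat_mul u 6
            push_cast at this
            exact this.symm
    push_cast
    calc 2 * (2 * (S : ℝ) * r) * (2 * (S : ℝ)) ^ r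
        ≤ Real.exp (6 * u) * (n * Real.exp (4 * u)) := by gcongr
      _ = n * (Real.exp (6 * u) * Real.exp (4 * u)) := by ring
      _ = _ := by rw [← Real.exp_add]; congr 2; ring

theorem ev_numerics (n d P q M : ℕ) (hn0 : 0 < n) (hd0 : 0 < d) (hP : 0 < P) (E B Y Z : ℝ)
    (hE : 1 ≤ E) (hB : 1 ≤ B)
    (hYdef : Y = 12 * B ^ ((1 : ℝ) / (n * d : ℕ)))
    (hZ : Z = n * ((P : ℝ) * Y ^ 2) ^ q)
    (hexp : ((2 * q * M : ℕ) : ℝ) ≤ n * E) :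
    1 ≤ Y ∧ 12 ^ (n * d) * B ≤ Y ^ (n * d) ∧
    (n : ℝ) * ((2 * Z + 1) ^ d) ^ M ≤
      n * (B * (12 ^ n * (3 * n * (P : ℝ) ^ q) ^ M) ^ d) ^ E := by
  have hn1 : (1 : ℝ) ≤ n := by exact_mod_cast hn0
  have hP1 : (1 : ℝ) ≤ P := by exact_mod_cast hP
  have hB1 : 1 ≤ B ^ ((1 : ℝ) / (n * d : ℕ)) := Real.one_le_rpow hB (by positivity)
  have hY1 : 1 ≤ Y := by rw [hYdef]; linarith
  have hYpow : Y ^ (n * d) = 12 ^ (n * d) * B := by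
    rw [hYdef, mul_pow, one_div, Real.rpow_inv_natCast_pow (by linarith) (by positivity)]
  refine ⟨hY1, hYpow.ge, ?_⟩
  have hY2 : 1 ≤ Y ^ 2 := one_le_pow₀ hY1
  have hZ1 : 1 ≤ Z := by
    rw [hZ]
    have : 1 ≤ ((P : ℝ) * Y ^ 2) ^ q := one_le_pow₀ (by nlinarith)
    nlinarith
  set Q : ℝ := 3 * n * (P : ℝ) ^ q with hQ
  have hQ1 : 1 ≤ Q := by
    have : 1 ≤ (P : ℝ) ^ q := one_le_pow₀ hP1
    nlinarith
  have hQ0 : 0 < Q := by linarith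
  have hY0 : 0 < Y := by linarith
  have hB0 : 0 < B := by linarith
  have h3 : 2 * Z + 1 ≤ Q * Y ^ (2 * q) := by
    have : Q * Y ^ (2 * q) = 3 * Z := by rw [hZ, hQ, mul_pow, pow_mul]; ring
    rw [this]; linarith
  have h4 : Y ^ (2 * q * M * d) ≤ (12 ^ (n * d) * B) ^ E := by
    rw [← hYpow, ← Real.rpow_natCast Y (n * d), ← Real.rpow_mul hY0.le, ← Real.rpow_natCast]
    apply Real.rpow_le_rpow_of_exponent_le hY1
    push_cast at hexp ⊢
    calc (2 * q * M * d : ℝ) ≤ (n * E) * d := by gcongr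
      _ = _ := by ring
  have h5 : Q ^ (M * d) ≤ (Q ^ (M * d)) ^ E := by
    conv_lhs => rw [← Real.rpow_one (Q ^ (M * d))]
    exact Real.rpow_le_rpow_of_exponent_le (one_le_pow₀ hQ1) hE
  refine mul_le_mul_of_nonneg_left ?_ (by positivity)
  calc ((2 * Z + 1) ^ d) ^ M ≤ ((Q * Y ^ (2 * q)) ^ d) ^ M := by
        have : 0 ≤ 2 * Z + 1 := by linarith
        gcongr
    _ = Q ^ (M * d) * Y ^ (2 * q * M * d) := by
        simp only [mul_pow, ← pow_mul]; ring_nf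
    _ ≤ (Q ^ (M * d)) ^ E * (12 ^ (n * d) * B) ^ E := by gcongr
    _ = (B * (12 ^ n * Q ^ M) ^ d) ^ E := by
        rw [← Real.mul_rpow (by positivity) (by positivity)]
        congr 1
        simp only [mul_pow, ← pow_mul]; ring
end part7

/-- upper bound for the number of extensions of a number field `K` of degree
`n > 2` and relative discriminant norm less than `X`. -/
theorem count_extensions_upper_bound :
    ∃ C : ℝ, 0 < C ∧
      ∀ n : ℕ, 2 < n →
        ∃ A c : ℝ, 0 < A ∧ 0 < c ∧
          ∀ (K : Type) [Field K] [NumberField K]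
            (Kbar : Type) [Field Kbar] [Algebra K Kbar] [IsAlgClosure K Kbar],
            ∀ X : ℝ, 1 ≤ X →
              {L : IntermediateField K Kbar |
                finrank K L = n ∧ (relDiscNorm K L : ℝ) < X}.Finite ∧
              (Nat.card {L : IntermediateField K Kbar |
                  finrank K L = n ∧ (relDiscNorm K L : ℝ) < X} : ℝ) ≤
                c * (X * ((NumberField.discr K).natAbs : ℝ) ^ n * A ^ (finrank ℚ K)) ^
                  (Real.exp (C * Real.sqrt (Real.log n))) := by
  refine ⟨10, by norm_num, fun n hn => ?_⟩
  obtain ⟨r, S, hr0, hS0, hS, hexp⟩ := ev_params n hn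
  have hn0 : 0 < n := by omega
  have hP : 0 < n * (n * (r * S)) := by positivity
  refine ⟨12 ^ n * (3 * n * ((n * (n * (r * S)) : ℕ) : ℝ) ^ (2 * S * r)) ^ ((2 * S) ^ r), n,
    by positivity, by positivity, ?_⟩
  intro K _ _ Kbar _ _ _ X hX
  have hD : (1 : ℝ) ≤ ((discr K).natAbs : ℝ) := by
    exact_mod_cast Int.natAbs_pos.2 (discr_ne_zero K)
  have hB : 1 ≤ X * ((discr K).natAbs : ℝ) ^ n := by
    have : (1 : ℝ) ≤ ((discr K).natAbs : ℝ) ^ n := one_le_pow₀ hD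
    nlinarith
  obtain ⟨h1, h2, h3⟩ := ev_numerics n (finrank ℚ K) (n * (n * (r * S))) (2 * S * r) ((2 * S) ^ r)
    hn0 finrank_pos hP (Real.exp (10 * Real.sqrt (Real.log n)))
    (X * ((discr K).natAbs : ℝ) ^ n) _ _ (Real.one_le_exp (by positivity)) hB rfl rfl hexp
  obtain ⟨h4, h5⟩ := ev_main K Kbar n r S hn0 hr0 hS0 hS X _ _ h1 h2 rfl
  exact ⟨h4, h5.trans h3⟩
end

section
/- For every ε > 0 there exists a constant C_ε > 0 such that for every integer n > 2 and every number field K, one has limsup_{X→∞} (log N_{K,n}(X) / log X) ≤ C_ε · n^ε, where N_{K,n}(X) denotes the number of intermediate fields K ⊆ L ⊆ K̄ with [L:K] = n and Δ_{L/K} < X. -/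
open NumberField Module

open MeasureTheory Metric in
theorem card_le_of_separated_aux {E : Type*} [NormedAddCommGroup E] [NormedSpace ℝ E]
    [FiniteDimensional ℝ E] (R : ℝ) (hR : 0 ≤ R) (s : Finset E) (hs : ∀ c ∈ s, ‖c‖ ≤ R)
    (h : ∀ c ∈ s, ∀ d ∈ s, c ≠ d → 1 ≤ ‖c - d‖) :
    (s.card : ℝ) ≤ (2 * R + 1) ^ finrank ℝ E := by
  borelize E
  let μ : Measure E := Measure.addHaar
  let δ : ℝ := (1 : ℝ) / 2
  let ρ : ℝ := R + (1 : ℝ) / 2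
  have ρpos : 0 < ρ := by positivity
  set A := ⋃ c ∈ s, ball (c : E) δ with hA
  have D : Set.Pairwise (s : Set E) (Function.onFun Disjoint fun c => ball (c : E) δ) := by
    rintro c hc d hd hcd
    apply ball_disjoint_ball
    rw [dist_eq_norm]
    convert! h c hc d hd hcd
    norm_num [δ]
  have A_subset : A ⊆ ball (0 : E) ρ := by
    refine Set.iUnion₂_subset fun x hx => ?_
    apply ball_subset_ball'
    rw [dist_zero_right]
    have := hs x hx
    simp only [δ, ρ]; linarith
  have I :
    (s.card : ENNReal) * ENNReal.ofReal (δ ^ finrank ℝ E) * μ (ball 0 1) ≤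
      ENNReal.ofReal (ρ ^ finrank ℝ E) * μ (ball 0 1) :=
    calc
      (s.card : ENNReal) * ENNReal.ofReal (δ ^ finrank ℝ E) * μ (ball 0 1) = μ A := by
        rw [hA, measure_biUnion_finset D fun c _ => measurableSet_ball]
        have I : 0 < δ := by norm_num [δ]
        simp only [μ.addHaar_ball_of_pos _ I]
        simp only [Finset.sum_const, nsmul_eq_mul, mul_assoc]
      _ ≤ μ (ball (0 : E) ρ) := measure_mono A_subset
      _ = ENNReal.ofReal (ρ ^ finrank ℝ E) * μ (ball 0 1) := by
        simp only [μ.addHaar_ball_of_pos _ ρpos]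
  have J : (s.card : ENNReal) * ENNReal.ofReal (δ ^ finrank ℝ E) ≤ ENNReal.ofReal (ρ ^ finrank ℝ E) :=
    (ENNReal.mul_le_mul_iff_left (measure_ball_pos _ _ zero_lt_one).ne' measure_ball_lt_top.ne).1 I
  have K := ENNReal.toReal_le_of_le_ofReal (pow_nonneg ρpos.le _) J
  have e : 2 * R + 1 = ρ * 2 := by simp only [ρ]; ring
  rw [e, mul_pow]
  simp only [δ, ENNReal.toReal_mul, ENNReal.toReal_natCast] at K
  rw [ENNReal.toReal_ofReal (by positivity), div_pow, one_pow, mul_one_div,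
    div_le_iff₀ (by positivity)] at K
  exact K

theorem pack_aux {L : Type*} [Field L] [NumberField L] (W : Submodule ℚ L) (R : ℝ) (hR : 0 ≤ R)
    (s : Finset L) (hW : ∀ x ∈ s, x ∈ W) (hi : ∀ x ∈ s, IsIntegral ℤ x)
    (hs : ∀ x ∈ s, house x ≤ R) : (s.card : ℝ) ≤ (2 * R + 1) ^ finrank ℚ W := by
  classical
  let b := Module.finBasis ℚ W
  let E : Submodule ℝ ((L →+* ℂ) → ℂ) :=
    Submodule.span ℝ (Set.range fun i => canonicalEmbedding L (b i : L))
  have hE : finrank ℝ E ≤ finrank ℚ W := by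
    have := finrank_range_le_card (R := ℝ) (b := fun i => canonicalEmbedding L (b i : L))
    simpa [Set.finrank] using this
  have hmem : ∀ x ∈ W, canonicalEmbedding L x ∈ E := by
    intro x hx
    have h1 := b.sum_repr ⟨x, hx⟩
    have h2 : x = ∑ i, (b.repr ⟨x, hx⟩ i) • (b i : L) := by
      have := congrArg W.subtype h1
      rw [map_sum] at this
      simpa only [map_smul, Submodule.subtype_apply] using this.symm
    rw [h2, map_sum]
    refine Submodule.sum_mem _ fun i _ => ?_
    have : canonicalEmbedding L ((b.repr ⟨x, hx⟩ i) • (b i : L)) =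
        ((b.repr ⟨x, hx⟩ i : ℚ) : ℝ) • canonicalEmbedding L (b i : L) := by
      ext φ
      simp [Algebra.smul_def]
    rw [this]
    exact Submodule.smul_mem _ _ (Submodule.subset_span ⟨i, rfl⟩)
  let f : s → E := fun x => ⟨canonicalEmbedding L x, hmem x (hW x x.2)⟩
  have hf : Function.Injective f := by
    intro x y hxy
    have := congrArg Subtype.val hxy
    exact Subtype.ext (canonicalEmbedding_injective L this)
  have key := card_le_of_separated_aux R hR (Finset.univ.map ⟨f, hf⟩) (by
    intro c hc
    simp only [Finset.mem_map, Finset.mem_univ, true_and, Function.Embedding.coeFn_mk] at hc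
    obtain ⟨x, rfl⟩ := hc
    exact hs x x.2) (by
    intro c hc d hd hcd
    simp only [Finset.mem_map, Finset.mem_univ, true_and, Function.Embedding.coeFn_mk] at hc hd
    obtain ⟨x, rfl⟩ := hc
    obtain ⟨y, rfl⟩ := hd
    have hne : (x : L) - y ≠ 0 := sub_ne_zero.2 fun h => hcd (by rw [Subtype.ext h])
    have := one_le_house_of_isIntegral ((hi x x.2).sub (hi y y.2)) hne
    rw [house, map_sub] at this
    exact this)
  rw [Finset.card_map, Finset.card_univ, Fintype.card_coe] at key
  exact key.trans (pow_le_pow_right₀ (by linarith) hE)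


open MeasureTheory Pointwise in
/-- Generalised Blichfeldt. -/
theorem blichfeldt_aux {E L : Type*} [MeasurableSpace E] {μ : Measure E} {F s : Set E}
    [AddGroup L] [Countable L] [AddAction L E]
    [MeasurableSpace L] [MeasurableVAdd L E] [VAddInvariantMeasure L E μ]
    (fund : IsAddFundamentalDomain L F μ) (hS : MeasurableSet s) (N : ℕ)
    (h : ∀ x : E, ∀ T : Finset L, (∀ g ∈ T, x ∈ g +ᵥ s) → T.card ≤ N) :
    μ s ≤ N * μ F := by
  classical
  have h1 : μ s = ∑' g : L, μ ((g +ᵥ s) ∩ F) := fund.measure_eq_tsum s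
  have hm : ∀ g : L, MeasurableSet (g +ᵥ s) := fun g => hS.const_vadd g
  have h2 : ∀ g : L, μ ((g +ᵥ s) ∩ F) = ∫⁻ x in F, (g +ᵥ s).indicator 1 x ∂μ := by
    intro g
    rw [lintegral_indicator_one (hm g), Measure.restrict_apply (hm g)]
  rw [h1]
  simp_rw [h2]
  rw [← lintegral_tsum (fun g => (measurable_one.indicator (hm g)).aemeasurable)]
  calc ∫⁻ x in F, ∑' g : L, (g +ᵥ s).indicator 1 x ∂μ ≤ ∫⁻ x in F, (N : ENNReal) ∂μ := by
        refine lintegral_mono fun x => ?_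
        rw [ENNReal.tsum_eq_iSup_sum]
        refine iSup_le fun T => ?_
        have : ∑ g ∈ T, (g +ᵥ s).indicator (1 : E → ENNReal) x =
            ((T.filter fun g => x ∈ g +ᵥ s).card : ENNReal) := by
          rw [Finset.card_filter]
          push_cast
          exact Finset.sum_congr rfl fun g _ => by simp [Set.indicator_apply]
        rw [this]
        exact_mod_cast h x _ (fun g hg => (Finset.mem_filter.1 hg).2)
    _ = N * μ F := by simp

open mixedEmbedding MeasureTheory Pointwise in
theorem lattice_count_aux {L : Type*} [Field L] [NumberField L] (R : ℝ) (hR : 0 < R) (N : ℕ)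
    (h : ∀ T : Finset L, (∀ x ∈ T, IsIntegral ℤ x ∧ house x ≤ R) → T.card ≤ N) :
    (R / 2) ^ finrank ℚ L ≤ N * √|(discr L : ℝ)| := by
  classical
  have h_fund := ZSpan.isAddFundamentalDomain' (latticeBasis L) volume
  have : Countable (Submodule.span ℤ (Set.range (latticeBasis L))).toAddSubgroup := by
    change Countable (Submodule.span ℤ (Set.range (latticeBasis L)))
    infer_instance
  obtain ⟨q, hq⟩ : ∃ q : NNReal, (q : ℝ) = R / 2 := ⟨⟨R / 2, by positivity⟩, rfl⟩
  let f : InfinitePlace L → NNReal := fun _ => q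
  have hmeas : MeasurableSet (convexBodyLT L f) := by
    unfold convexBodyLT
    refine (MeasurableSet.univ_pi fun i => measurableSet_ball).prod
      (MeasurableSet.univ_pi fun i => measurableSet_ball)
  have key := blichfeldt_aux h_fund hmeas N (by
    intro x T hT
    rcases T.eq_empty_or_nonempty with rfl | ⟨g0, hg0⟩
    · simp
    have hlat : ∀ g : (Submodule.span ℤ (Set.range (latticeBasis L))).toAddSubgroup,
        ∃ a : L, IsIntegral ℤ a ∧ mixedEmbedding L a = (g : mixedSpace L) := by
      intro g
      have := g.2
      rw [Submodule.mem_toAddSubgroup, mem_span_latticeBasis] at this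
      obtain ⟨a, hag⟩ := this
      exact ⟨algebraMap _ _ (a : 𝓞 L), RingOfIntegers.isIntegral_coe _, hag⟩
    choose a ha hag using hlat
    have hinj : Function.Injective fun g => a g - a g0 := by
      intro g g' hgg
      have : a g = a g' := by simpa using hgg
      apply Subtype.ext
      rw [← hag, ← hag, this]
    rw [← Finset.card_image_of_injective T hinj]
    apply h
    intro y hy
    obtain ⟨g, hg, rfl⟩ := Finset.mem_image.1 hy
    refine ⟨(ha g).sub (ha g0), ?_⟩
    have h1 := hT g hg
    have h2 := hT g0 hg0
    rw [Set.mem_vadd_set_iff_neg_vadd_mem] at h1 h2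
    have hnorm : ∀ y ∈ convexBodyLT L f, ∀ w : InfinitePlace L, normAtPlace w y < R / 2 := by
      intro y hy w
      rw [← hq]
      rw [convexBodyLT] at hy
      obtain ⟨hy1, hy2⟩ := hy
      rcases w.isReal_or_isComplex with hw | hw
      · rw [normAtPlace_apply_of_isReal hw]
        exact mem_ball_zero_iff.1 (hy1 ⟨w, hw⟩ (Set.mem_univ _))
      · rw [normAtPlace_apply_of_isComplex hw]
        exact mem_ball_zero_iff.1 (hy2 ⟨w, hw⟩ (Set.mem_univ _))
    have hw : ∀ w : InfinitePlace L, w (a g - a g0) ≤ R := by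
      intro w
      rw [← normAtPlace_apply, map_sub, hag, hag]
      have e : (g : mixedSpace L) - g0 = (-g0 +ᵥ x) + -(-g +ᵥ x) := by
        simp only [AddSubgroup.vadd_def, vadd_eq_add, AddSubgroup.coe_neg]
        abel
      rw [e]
      refine (normAtPlace_add_le _ _ _).trans ?_
      rw [normAtPlace_neg]
      have := hnorm _ h1 w
      have := hnorm _ h2 w
      linarith
    rw [house, pi_norm_le_iff_of_nonneg hR.le]
    intro φ
    exact hw (InfinitePlace.mk φ))
  rw [convexBodyLT_volume, volume_fundamentalDomain_latticeBasis] at key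
  have h1 : ∏ w : InfinitePlace L, f w ^ w.mult =
      q ^ finrank ℚ L := by
    rw [← InfinitePlace.sum_mult_eq, ← Finset.prod_pow_eq_pow_sum]
  rw [h1] at key
  have h2 : ((q ^ finrank ℚ L : NNReal) : ENNReal) ≤
      ((N * NNReal.sqrt ‖discr L‖₊ : NNReal) : ENNReal) := by
    calc _ ≤ _ := le_mul_of_one_le_left (zero_le)
            (by exact_mod_cast one_le_convexBodyLTFactor L)
      _ ≤ _ := key
      _ ≤ N * NNReal.sqrt ‖discr L‖₊ := by
        gcongr
        refine mul_le_of_le_one_left (zero_le) (pow_le_one₀ (zero_le) ?_)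
        simp
      _ = _ := by push_cast; rfl
  have h3 := NNReal.coe_le_coe.2 (ENNReal.coe_le_coe.1 h2)
  rw [← hq]
  simpa [Int.norm_eq_abs] using h3

theorem dim_gt_aux {L : Type*} [Field L] [NumberField L] (R : ℝ) (hR1 : 1 ≤ R)
    (hR : 12 ^ finrank ℚ L * |(discr L : ℝ)| < R ^ finrank ℚ L) :
    finrank ℚ L < 2 * finrank ℚ (Submodule.span ℚ {x : L | IsIntegral ℤ x ∧ house x ≤ R}) := by
  set W := Submodule.span ℚ {x : L | IsIntegral ℤ x ∧ house x ≤ R} with hW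
  by_contra! hlt
  set m := finrank ℚ L
  set w := finrank ℚ W
  have h1 := lattice_count_aux (L := L) R (by linarith) ⌊(2 * R + 1) ^ w⌋₊ (by
    intro T hT
    refine Nat.le_floor ?_
    exact pack_aux W R (by linarith) T (fun x hx => Submodule.subset_span (hT x hx))
      (fun x hx => (hT x hx).1) (fun x hx => (hT x hx).2))
  have h2 : (⌊(2 * R + 1) ^ w⌋₊ : ℝ) ≤ (3 * R) ^ w :=
    (Nat.floor_le (by positivity)).trans (by gcongr; linarith)
  have h3 : (R / 2) ^ m ≤ (3 * R) ^ w * √|(discr L : ℝ)| :=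
    h1.trans (by gcongr)
  have h4 : ((R / 2) ^ m) ^ 2 ≤ (3 * R) ^ m * |(discr L : ℝ)| := by
    calc ((R / 2) ^ m) ^ 2 ≤ ((3 * R) ^ w * √|(discr L : ℝ)|) ^ 2 := by gcongr
      _ = (3 * R) ^ (2 * w) * |(discr L : ℝ)| := by
        rw [mul_pow, Real.sq_sqrt (abs_nonneg _), ← pow_mul, mul_comm w]
      _ ≤ _ := by
        gcongr
        linarith
  have h5 : ((R / 2) ^ m) ^ 2 * 12 ^ m = (3 * R) ^ m * R ^ m := by
    rw [← pow_mul, mul_comm m, pow_mul, ← mul_pow, ← mul_pow]; congr 1; ring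
  have h6 : (0 : ℝ) < (3 * R) ^ m := by positivity
  have h7 : (3 * R) ^ m * R ^ m ≤ (3 * R) ^ m * (12 ^ m * |(discr L : ℝ)|) := by
    rw [← h5]
    calc _ ≤ (3 * R) ^ m * |(discr L : ℝ)| * 12 ^ m := by gcongr
      _ = _ := by ring
  have := le_of_mul_le_mul_left h7 h6
  linarith

theorem mul_self_eq_top_aux {L : Type*} [Field L] [NumberField L] (W : Submodule ℚ L)
    (h : finrank ℚ L < 2 * finrank ℚ W) : W * W = ⊤ := by
  by_contra hne
  obtain ⟨f, hf0, hf⟩ := Submodule.exists_le_ker_of_lt_top _ (lt_top_iff_ne_top.2 hne)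
  let Φ : L →ₗ[ℚ] Dual ℚ L := (LinearMap.mul ℚ L).compr₂ f
  have hΦ : Function.Injective Φ := by
    rw [injective_iff_map_eq_zero]
    intro x hx
    by_contra hx0
    apply hf0
    ext z
    have := LinearMap.congr_fun hx (x⁻¹ * z)
    simpa [Φ, hx0] using this
  have h1 : W.map Φ ≤ W.dualAnnihilator := by
    rintro _ ⟨x, hx, rfl⟩
    rw [Submodule.mem_dualAnnihilator]
    intro y hy
    exact hf (Submodule.mul_mem_mul hx hy)
  have h2 := Submodule.finrank_mono h1
  rw [← (Submodule.equivMapOfInjective Φ hΦ W).finrank_eq] at h2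
  have h3 := Subspace.finrank_add_finrank_dualAnnihilator_eq W
  omega

theorem exists_basis_aux {L : Type*} [Field L] [NumberField L] (R : ℝ) (hR1 : 1 ≤ R)
    (hR : 12 ^ finrank ℚ L * |(discr L : ℝ)| < R ^ finrank ℚ L) :
    ∃ b : Basis (Fin (finrank ℚ L)) ℚ L, ∀ i, IsIntegral ℤ (b i) ∧ house (b i) ≤ R ^ 2 := by
  classical
  have h1 := mul_self_eq_top_aux _ (dim_gt_aux R hR1 hR)
  rw [Submodule.span_mul_span] at h1
  let b := Basis.ofSpan (le_of_eq h1.symm)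
  have hb := Basis.ofSpan_subset (le_of_eq h1.symm)
  let e := Fintype.equivFinOfCardEq (finrank_eq_card_basis b).symm
  refine ⟨b.reindex e, fun i => ?_⟩
  rw [Basis.reindex_apply]
  obtain ⟨x, ⟨hx1, hx2⟩, y, ⟨hy1, hy2⟩, hxy⟩ := hb ⟨e.symm i, rfl⟩
  have hxy' : x * y = b (e.symm i) := hxy
  rw [← hxy']
  refine ⟨hx1.mul hy1, (house_mul_le x y).trans ?_⟩
  rw [sq]
  exact mul_le_mul hx2 hy2 (house_nonneg _) (by linarith)


theorem generic_aux {K L : Type*} [Field K] [NumberField K] [Field L] [NumberField L] [Algebra K L]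
    {n r d m : ℕ} (hn : finrank K L = n) (b : Basis (Fin m) ℚ L)
    (σ : Fin n → Fin r → ℕ) (hσ : ∀ t i, σ t i ≤ d)
    (hs : ∀ t, ∑ i, σ t i * (d + 1) ^ (i : ℕ) = t) :
    ∃ c : Fin r → Fin m → ℕ, (∀ i j, c i j ≤ n * (r * d)) ∧
      LinearIndependent K (fun t : Fin n => ∏ i, (∑ j, (c i j : L) * b j) ^ σ t i) := by
  classical
  let E := AlgebraicClosure L
  have hfd : FiniteDimensional K L := Module.Finite.of_restrictScalars_finite ℚ K L
  have hcard : Fintype.card (L →ₐ[K] E) = n := by rw [AlgHom.card, hn]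
  let e : Fin n ≃ (L →ₐ[K] E) := (Fintype.equivFinOfCardEq hcard).symm
  let M : Matrix (Fin n) (Fin n) (MvPolynomial (Fin r × Fin m) E) := fun t s =>
    ∏ i, (∑ j, MvPolynomial.X (i, j) * MvPolynomial.C (e s (b j))) ^ σ t i
  let P := M.det
  have hev : ∀ v : Fin r × Fin m → E, MvPolynomial.eval v P =
      Matrix.det (fun t s => ∏ i, (∑ j, v (i, j) * e s (b j)) ^ σ t i) := by
    intro v
    rw [RingHom.map_det]
    congr 1
    ext t s
    rw [RingHom.mapMatrix_apply, Matrix.map_apply]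
    simp only [M]
    rw [map_prod]
    simp
  have hdet : ∀ x : Fin r → L, Matrix.det (fun t s => ∏ i, (e s (x i)) ^ σ t i) ^ 2 =
      algebraMap K E (Algebra.discr K (fun t : Fin n => ∏ i, x i ^ σ t i)) := by
    intro x
    rw [Algebra.discr_eq_det_embeddingsMatrixReindex_pow_two K E _ e]
    congr 2
    ext t s
    simp [Algebra.embeddingsMatrixReindex, Algebra.embeddingsMatrix]
  have hP : P ≠ 0 := by
    intro hP0
    let pb := Field.powerBasisOfFiniteOfSeparable K L
    have hdim : n = pb.dim := by rw [← hn, pb.finrank]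
    let x : Fin r → L := fun i => pb.gen ^ ((d + 1) ^ (i : ℕ))
    have h1 := hev (fun p => algebraMap ℚ E (b.repr (x p.1) p.2))
    have h2 : (fun (t s : Fin n) => ∏ i, (∑ j, algebraMap ℚ E (b.repr (x i) j) * e s (b j)) ^ σ t i)
        = fun t s => ∏ i, (e s (x i)) ^ σ t i := by
      funext t s
      refine Finset.prod_congr rfl fun i _ => ?_
      congr 1
      conv_rhs => rw [← b.sum_repr (x i)]
      rw [map_sum]
      refine Finset.sum_congr rfl fun j _ => ?_
      rw [Algebra.smul_def, map_mul]
      simp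
    rw [hP0, map_zero, h2] at h1
    have h3 := hdet x
    rw [← h1, zero_pow two_ne_zero] at h3
    have h4 := (map_eq_zero (algebraMap K E)).1 h3.symm
    refine Algebra.discr_not_zero_of_basis K (pb.basis.reindex (finCongr hdim).symm) ?_
    rw [← h4]
    congr 1
    ext t
    simp only [x, ← pow_mul, Finset.prod_pow_eq_pow_sum, Basis.reindex_apply, PowerBasis.coe_basis]
    congr 1
    have e1 : (((finCongr hdim).symm.symm t : Fin pb.dim) : ℕ) = t := rfl
    rw [e1, ← hs t]
    exact Finset.sum_congr rfl fun i _ => mul_comm _ _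
  have hdeg : ∀ p, P.degreeOf p ≤ n * (r * d) := by
    intro p
    refine (MvPolynomial.degreeOf_le_totalDegree _ _).trans ?_
    simp only [P, Matrix.det_apply]
    refine MvPolynomial.totalDegree_finsetSum_le fun π _ => ?_
    refine (MvPolynomial.totalDegree_smul_le _ _).trans ?_
    refine (MvPolynomial.totalDegree_finsetProd _ _).trans ?_
    refine (Finset.sum_le_card_nsmul _ _ (r * d) fun t _ => ?_).trans (by simp)
    refine (MvPolynomial.totalDegree_finsetProd _ _).trans ?_
    refine (Finset.sum_le_card_nsmul _ _ d fun i _ => ?_).trans (by simp)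
    refine (MvPolynomial.totalDegree_pow _ _).trans ?_
    refine (Nat.mul_le_mul (hσ _ _) (?_ : _ ≤ 1)).trans (by simp)
    refine MvPolynomial.totalDegree_finsetSum_le fun j _ => ?_
    refine (MvPolynomial.totalDegree_mul _ _).trans ?_
    simp
  by_contra! hcon
  apply hP
  refine MvPolynomial.eq_zero_of_eval_zero_at_prod_finset P
    (fun _ => (Finset.range (n * (r * d) + 1)).map ⟨Nat.cast, Nat.cast_injective⟩) ?_ ?_
  · intro p
    rw [Finset.card_map, Finset.card_range]
    exact Nat.lt_succ_of_le (hdeg p)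
  · intro v hv
    simp only [Finset.mem_map, Finset.mem_range, Function.Embedding.coeFn_mk] at hv
    choose c hc hcv using hv
    have h1 := hcon (fun i j => c (i, j)) (fun i j => Nat.le_of_lt_succ (hc (i, j)))
    have h2 := Algebra.discr_zero_of_not_linearIndependent K h1
    have h3 := hdet (fun i => ∑ j, (c (i, j) : L) * b j)
    rw [h2, map_zero] at h3
    rw [hev]
    rw [← pow_eq_zero_iff two_ne_zero, ← h3]
    congr 2
    funext t s
    refine Finset.prod_congr rfl fun i _ => ?_
    congr 1
    rw [map_sum]
    refine Finset.sum_congr rfl fun j _ => ?_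
    rw [map_mul, map_natCast, hcv]

theorem iso_aux {K L L' : Type*} [Field K] [CharZero K] [Field L] [Algebra K L]
    [FiniteDimensional K L] [Field L'] [Algebra K L'] [FiniteDimensional K L']
    {n r : ℕ} (hn : finrank K L = n) (hn' : finrank K L' = n)
    (σ : Fin n → Fin r → ℕ) (t0 : Fin n) (ht0 : ∀ i, σ t0 i = 0)
    (x : Fin r → L) (x' : Fin r → L')
    (hli : LinearIndependent K (fun t : Fin n => ∏ i, x i ^ σ t i))
    (hli' : LinearIndependent K (fun t : Fin n => ∏ i, x' i ^ σ t i))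
    (h : ∀ t s, Algebra.trace K L ((∏ i, x i ^ σ t i) * ∏ i, x i ^ σ s i) =
      Algebra.trace K L' ((∏ i, x' i ^ σ t i) * ∏ i, x' i ^ σ s i))
    (h' : ∀ k t s, Algebra.trace K L (x k * (∏ i, x i ^ σ t i) * ∏ i, x i ^ σ s i) =
      Algebra.trace K L' (x' k * (∏ i, x' i ^ σ t i) * ∏ i, x' i ^ σ s i)) :
    Nonempty (L ≃ₐ[K] L') := by
  classical
  set u : Fin n → L := fun t => ∏ i, x i ^ σ t i with hu
  set u' : Fin n → L' := fun t => ∏ i, x' i ^ σ t i with hu'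
  have : Nonempty (Fin n) := ⟨t0⟩
  let B := basisOfLinearIndependentOfCardEqFinrank hli (by simp [hn])
  let B' := basisOfLinearIndependentOfCardEqFinrank hli' (by simp [hn'])
  have hB : ∀ t, B t = u t := fun t => by simp [B]
  have hB' : ∀ t, B' t = u' t := fun t => by simp [B']
  let φ : L ≃ₗ[K] L' := B.equiv B' (Equiv.refl _)
  have hφ : ∀ t, φ (u t) = u' t := fun t => by
    rw [← hB, ← hB']; simp [φ]
  have hform : ∀ a b, Algebra.trace K L' (φ a * φ b) = Algebra.trace K L (a * b) := by
    have : ((LinearMap.mul K L').compr₂ (Algebra.trace K L')).compl₁₂ φ.toLinearMap φ.toLinearMap =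
        (LinearMap.mul K L).compr₂ (Algebra.trace K L) := by
      refine B.ext fun t => B.ext fun s => ?_
      simp only [LinearMap.compl₁₂_apply, LinearMap.compr₂_apply, LinearMap.mul_apply',
        LinearEquiv.coe_coe, hB, hφ]
      exact (h t s).symm
    intro a b
    exact LinearMap.congr_fun (LinearMap.congr_fun this a) b
  have hx : ∀ i a, φ (x i * a) = x' i * φ a := by
    intro i
    have : φ.toLinearMap ∘ₗ LinearMap.mulLeft K (x i) =
        LinearMap.mulLeft K (x' i) ∘ₗ φ.toLinearMap := by
      refine B.ext fun t => ?_
      simp only [LinearMap.comp_apply, LinearMap.mulLeft_apply, LinearEquiv.coe_coe, hB, hφ]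
      rw [← sub_eq_zero]
      refine (traceForm_nondegenerate K L').1 _ ?_
      have : (LinearMap.mul K L').compr₂ (Algebra.trace K L') (φ (x i * u t) - x' i * u' t) = 0 := by
        refine B'.ext fun s => ?_
        rw [LinearMap.compr₂_apply, LinearMap.mul_apply', hB', LinearMap.zero_apply, sub_mul,
          map_sub]
        rw [← hφ s, hform, hφ s, sub_eq_zero]
        exact h' i t s
      intro z
      exact LinearMap.congr_fun this z
    intro a
    exact LinearMap.congr_fun this a
  have hpow : ∀ i k a, φ (x i ^ k * a) = x' i ^ k * φ a := by
    intro i k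
    induction k with
    | zero => intro a; simp
    | succ k ih => intro a; rw [pow_succ, mul_assoc, ih, hx, pow_succ, mul_assoc]
  have hprod : ∀ t a, φ (u t * a) = u' t * φ a := by
    intro t
    have : ∀ (S : Finset (Fin r)) a, φ ((∏ i ∈ S, x i ^ σ t i) * a) =
        (∏ i ∈ S, x' i ^ σ t i) * φ a := by
      intro S
      induction S using Finset.induction_on with
      | empty => intro a; simp
      | insert i S hi ih =>
        intro a
        rw [Finset.prod_insert hi, Finset.prod_insert hi, mul_assoc, hpow, ih, mul_assoc]
    exact this _
  have hmul : ∀ a b, φ (a * b) = φ a * φ b := by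
    intro a b
    have : φ.toLinearMap ∘ₗ LinearMap.mulRight K b =
        LinearMap.mulRight K (φ b) ∘ₗ φ.toLinearMap := by
      refine B.ext fun t => ?_
      simp only [LinearMap.comp_apply, LinearMap.mulRight_apply, LinearEquiv.coe_coe, hB, hφ]
      exact hprod t b
    exact LinearMap.congr_fun this a
  have h1 : φ 1 = 1 := by
    have e1 : u t0 = 1 := by simp [hu, ht0]
    have e2 : u' t0 = 1 := by simp [hu', ht0]
    rw [← e1, hφ, e2]
  exact ⟨AlgEquiv.ofLinearEquiv φ h1 hmul⟩

theorem digits_aux {n r d : ℕ} (hd : n ≤ (d + 1) ^ r) :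
    ∃ σ : Fin n → Fin r → ℕ, (∀ t i, σ t i ≤ d) ∧
      (∀ t, ∑ i, σ t i * (d + 1) ^ (i : ℕ) = t) := by
  refine ⟨fun t i => finFunctionFinEquiv.symm (Fin.castLE hd t) i, fun t i => ?_, fun t => ?_⟩
  · exact Nat.le_of_lt_succ (finFunctionFinEquiv.symm (Fin.castLE hd t) i).2
  · rw [← finFunctionFinEquiv_apply, Equiv.apply_symm_apply]
    rfl

theorem trace_house_aux {K L : Type*} [Field K] [NumberField K] [Field L] [NumberField L]
    [Algebra K L] (y : L) : house (Algebra.trace K L y) ≤ finrank K L * house y := by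
  have hfd : FiniteDimensional K L := Module.Finite.of_restrictScalars_finite ℚ K L
  rw [house, pi_norm_le_iff_of_nonneg (by have := house_nonneg y; positivity)]
  intro φ
  let := φ.toAlgebra
  have h1 : canonicalEmbedding K (Algebra.trace K L y) φ = algebraMap K ℂ (Algebra.trace K L y) := rfl
  rw [h1, trace_eq_sum_embeddings ℂ]
  refine (norm_sum_le _ _).trans ?_
  refine (Finset.sum_le_card_nsmul _ _ (house y) fun τ _ => ?_).trans ?_
  · exact norm_embedding_le_house y τ.toRingHom
  · rw [Finset.card_univ, AlgHom.card, nsmul_eq_mul]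

theorem data_aux {K : Type*} [Field K] [NumberField K]
    {n r d : ℕ} (hn0 : 0 < n) (σ : Fin n → Fin r → ℕ) (hσ : ∀ t i, σ t i ≤ d)
    (hs : ∀ t, ∑ i, σ t i * (d + 1) ^ (i : ℕ) = t) :
    ∃ Z0 : ℝ, 1 ≤ Z0 ∧ ∀ X : ℝ, 1 ≤ X → ∀ (L : Type) [Field L] [NumberField L] [Algebra K L],
      finrank K L = n → (Ideal.absNorm (differentIdeal (𝓞 K) (𝓞 L)) : ℝ) < X →
      ∃ x : Fin r → L, LinearIndependent K (fun t : Fin n => ∏ i, x i ^ σ t i) ∧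
        ∀ e : Fin r → ℕ, (∀ i, e i ≤ 2 * d + 1) →
          IsIntegral ℤ (Algebra.trace K L (∏ i, x i ^ e i)) ∧
          house (Algebra.trace K L (∏ i, x i ^ e i)) ≤
            Z0 * X ^ (2 * ((r * (2 * d + 1) : ℕ) : ℝ) / (finrank ℚ K * n : ℝ)) := by
  set k := finrank ℚ K with hk
  have hk0 : 0 < k := finrank_pos
  set p := r * (2 * d + 1) with hp
  set m := k * n with hm
  have hm0 : 0 < m := Nat.mul_pos hk0 hn0
  set D : ℝ := ((discr K).natAbs : ℝ) ^ n with hD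
  have hD1 : 1 ≤ D := by
    refine one_le_pow₀ ?_
    exact_mod_cast Int.natAbs_pos.2 (discr_ne_zero K)
  set Y0 : ℝ := (m * (n * (r * d)) + 1) * (169 * D ^ (2 / (m : ℝ))) with hY0
  have hDp : 1 ≤ D ^ (2 / (m : ℝ)) := Real.one_le_rpow hD1 (by positivity)
  have hY01 : 1 ≤ Y0 := by
    have : (0 : ℝ) ≤ m * (n * (r * d)) := by positivity
    rw [hY0]
    nlinarith
  refine ⟨n * Y0 ^ p, one_le_mul_of_one_le_of_one_le (by exact_mod_cast hn0) (one_le_pow₀ hY01), ?_⟩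
  intro X hX L _ _ _ hn hΔ
  have hfd : FiniteDimensional K L := Module.Finite.of_restrictScalars_finite ℚ K L
  have hmL : finrank ℚ L = m := by rw [← finrank_mul_finrank ℚ K L, hn]
  have hdisc : |(discr L : ℝ)| ≤ X * D := by
    have h1 := natAbs_discr_eq_absNorm_differentIdeal_mul_natAbs_discr_pow K (𝓞 K) L (𝓞 L)
    rw [hn] at h1
    have h2 : |(discr L : ℝ)| = ((discr L).natAbs : ℝ) := by
      rw [Nat.cast_natAbs, Int.cast_abs]
    rw [h2, h1]
    push_cast
    rw [hD]
    have := hΔ.le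
    gcongr
  have hXD : 1 ≤ X * D := one_le_mul_of_one_le_of_one_le hX hD1
  set R : ℝ := 13 * (X * D) ^ (1 / (m : ℝ)) with hR
  have hXDp : 1 ≤ (X * D) ^ (1 / (m : ℝ)) := Real.one_le_rpow hXD (by positivity)
  have hR1 : 1 ≤ R := by linarith
  have hRm : R ^ m = 13 ^ m * (X * D) := by
    rw [hR, mul_pow]
    congr 1
    rw [← Real.rpow_natCast, ← Real.rpow_mul (by positivity), one_div,
      inv_mul_cancel₀ (by positivity), Real.rpow_one]
  have hR2 : R ^ 2 = 169 * D ^ (2 / (m : ℝ)) * X ^ (2 / (m : ℝ)) := by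
    rw [hR, mul_pow, ← Real.rpow_natCast ((X * D) ^ _), ← Real.rpow_mul (by positivity),
      Real.mul_rpow (by positivity) (by positivity)]
    have : 1 / (m : ℝ) * ((2 : ℕ) : ℝ) = 2 / m := by push_cast; ring
    rw [this]
    ring
  obtain ⟨b, hb⟩ := exists_basis_aux (L := L) R hR1 (by
    rw [hmL, hRm]
    calc (12 : ℝ) ^ m * |(discr L : ℝ)| ≤ 12 ^ m * (X * D) := by gcongr
      _ < 13 ^ m * (X * D) := by
        have : (12 : ℝ) ^ m < 13 ^ m := pow_lt_pow_left₀ (by norm_num) (by norm_num) hm0.ne'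
        gcongr)
  obtain ⟨c, hc, hli⟩ := generic_aux hn b σ hσ hs
  refine ⟨fun i => ∑ j, (c i j : L) * b j, hli, ?_⟩
  set x : Fin r → L := fun i => ∑ j, (c i j : L) * b j with hx
  have hxi : ∀ i, IsIntegral ℤ (x i) := by
    intro i
    refine IsIntegral.sum _ fun j _ => ?_
    have h1 : IsIntegral ℤ ((c i j : ℕ) : L) := by
      have := isIntegral_algebraMap (R := ℤ) (A := L) (x := (c i j : ℤ))
      simpa using this
    exact h1.mul (hb j).1
  have hxh : ∀ i, house (x i) ≤ Y0 * X ^ (2 / (m : ℝ)) := by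
    intro i
    calc house (x i) ≤ ∑ j, house ((c i j : L) * b j) := house_sum_le_sum_house _ _
      _ ≤ ∑ j : Fin (finrank ℚ L), ((n * (r * d) : ℕ) : ℝ) * R ^ 2 := by
        refine Finset.sum_le_sum fun j _ => ?_
        rw [house_nat_mul]
        have h1 : (c i j : ℝ) ≤ ((n * (r * d) : ℕ) : ℝ) := by exact_mod_cast hc i j
        exact mul_le_mul h1 (hb j).2 (house_nonneg _) (by positivity)
      _ = (m * (n * (r * d))) * R ^ 2 := by
        rw [Finset.sum_const, Finset.card_univ, Fintype.card_fin, hmL, nsmul_eq_mul]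
        push_cast; ring
      _ ≤ (m * (n * (r * d)) + 1) * R ^ 2 := by
        gcongr; linarith
      _ = _ := by rw [hR2, hY0]; ring
  set Y := Y0 * X ^ (2 / (m : ℝ)) with hY
  have hY1 : 1 ≤ Y := one_le_mul_of_one_le_of_one_le hY01 (Real.one_le_rpow hX (by positivity))
  intro e he
  refine ⟨Algebra.isIntegral_trace (IsIntegral.prod _ fun i _ => (hxi i).pow _), ?_⟩
  refine (trace_house_aux _).trans ?_
  have h1 : house (∏ i, x i ^ e i) ≤ Y ^ p := by
    rw [house, pi_norm_le_iff_of_nonneg (by positivity)]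
    intro φ
    have h2 : canonicalEmbedding L (∏ i, x i ^ e i) φ = ∏ i, φ (x i) ^ e i := by
      simp
    rw [h2, norm_prod]
    calc ∏ i, ‖φ (x i) ^ e i‖ ≤ ∏ i : Fin r, Y ^ (2 * d + 1) := by
          refine Finset.prod_le_prod (fun i _ => norm_nonneg _) fun i _ => ?_
          rw [norm_pow]
          calc ‖φ (x i)‖ ^ e i ≤ Y ^ e i := by
                gcongr
                exact (norm_embedding_le_house _ _).trans (hxh i)
            _ ≤ _ := pow_le_pow_right₀ hY1 (he i)
      _ = Y ^ p := by
        rw [Finset.prod_const, Finset.card_univ, Fintype.card_fin, ← pow_mul, hp, mul_comm]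
  rw [hn]
  have h3 : Y ^ p = Y0 ^ p * X ^ (2 * (p : ℝ) / (k * n : ℝ)) := by
    rw [hY, mul_pow, ← Real.rpow_natCast (X ^ _), ← Real.rpow_mul (by positivity)]
    congr 2
    rw [hm]; push_cast; ring
  rw [mul_assoc, ← h3]
  gcongr

theorem count_aux (K : Type) [Field K] [NumberField K]
    (Kbar : Type) [Field Kbar] [Algebra K Kbar] [IsAlgClosure K Kbar]
    {n r d : ℕ} (hn0 : 0 < n) (hd : n ≤ (d + 1) ^ r) :
    ∃ A : ℝ, 1 ≤ A ∧ ∀ X : ℝ, 1 ≤ X →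
      (Nat.card {L : IntermediateField K Kbar | finrank K L = n ∧ (relDiscNorm K L : ℝ) < X} : ℝ)
        ≤ A * X ^ (2 * ((r * (2 * d + 1) : ℕ) : ℝ) * (((2 * d + 2) ^ r : ℕ) : ℝ) / n) := by
  classical
  obtain ⟨σ, hσ, hs⟩ := digits_aux hd
  obtain ⟨Z0, hZ0, hdata⟩ := data_aux (K := K) hn0 σ hσ hs
  have : IsAlgClosed Kbar := IsAlgClosure.isAlgClosed K
  set k := finrank ℚ K with hk
  have hk0 : 0 < k := finrank_pos
  set q := (2 * d + 2) ^ r with hq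
  set p := r * (2 * d + 1) with hp
  refine ⟨n * (3 * Z0) ^ (k * q), one_le_mul_of_one_le_of_one_le (by exact_mod_cast hn0)
    (one_le_pow₀ (by linarith)), ?_⟩
  intro X hX
  set F := {L : IntermediateField K Kbar | finrank K L = n ∧ (relDiscNorm K L : ℝ) < X} with hF
  by_cases hfin : Finite F
  swap
  · have : Infinite F := not_finite_iff_infinite.1 hfin
    rw [Nat.card_eq_zero_of_infinite]
    simp only [Nat.cast_zero]
    positivity
  have : Fintype F := Fintype.ofFinite F
  set Z := Z0 * X ^ (2 * (p : ℝ) / (k * n : ℝ)) with hZ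
  have hZ1 : 1 ≤ Z := one_le_mul_of_one_le_of_one_le hZ0 (Real.one_le_rpow hX (by positivity))
  -- integers of `K` of bounded house
  set S : Set K := {a | IsIntegral ℤ a ∧ house a ≤ Z} with hS
  have hSfin : ∀ T : Finset K, (∀ a ∈ T, a ∈ S) → (T.card : ℝ) ≤ (2 * Z + 1) ^ k := by
    intro T hT
    have := pack_aux (⊤ : Submodule ℚ K) Z (by linarith) T (fun _ _ => trivial)
      (fun a ha => (hT a ha).1) (fun a ha => (hT a ha).2)
    rwa [finrank_top] at this
  have hSf : S.Finite := by
    by_contra hinf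
    obtain ⟨T, hT, hTc⟩ := Set.Infinite.exists_subset_card_eq hinf (⌊(2 * Z + 1) ^ k⌋₊ + 1)
    have h1 := Nat.le_floor (hSfin T hT)
    omega
  have hfdim : ∀ L : F, FiniteDimensional K (L : IntermediateField K Kbar) := fun L =>
    FiniteDimensional.of_finrank_pos (by rw [L.2.1]; exact hn0)
  have hx : ∀ L : F, ∃ x : Fin r → (L : IntermediateField K Kbar),
      LinearIndependent K (fun t : Fin n => ∏ i, x i ^ σ t i) ∧
        ∀ e : Fin r → ℕ, (∀ i, e i ≤ 2 * d + 1) →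
          Algebra.trace K (L : IntermediateField K Kbar) (∏ i, x i ^ e i) ∈ S := by
    intro L
    have := hfdim L
    have hc : CharZero (L : IntermediateField K Kbar) :=
      charZero_of_injective_algebraMap (algebraMap K _).injective
    have hf : FiniteDimensional ℚ (L : IntermediateField K Kbar) := Module.Finite.trans (R := ℚ) K _
    have hnf : NumberField (L : IntermediateField K Kbar) :=
      { to_charZero := inferInstance, to_finiteDimensional := inferInstance }
    refine hdata X hX _ L.2.1 ?_
    have h1 := L.2.2
    rw [relDiscNorm, dif_pos this] at h1
    exact h1
  choose x hli hxS using hx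
  let f : F → (Fin r → Fin (2 * d + 2)) → K := fun L e =>
    Algebra.trace K (L : IntermediateField K Kbar) (∏ i, x L i ^ (e i : ℕ))
  have hfS : ∀ L, f L ∈ Fintype.piFinset (fun _ => hSf.toFinset) := by
    intro L
    rw [Fintype.mem_piFinset]
    intro e
    rw [Set.Finite.mem_toFinset]
    exact hxS L (fun i => e i) (fun i => Nat.le_of_lt_succ (e i).2)
  have hcard := Finset.card_le_mul_card_image (f := f) (Finset.univ : Finset F) n (by
    intro y hy
    obtain ⟨L0, _, rfl⟩ := Finset.mem_image.1 hy
    have := hfdim L0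
    have hemb : Fintype.card ((L0 : IntermediateField K Kbar) →ₐ[K] Kbar) = n := by
      rw [AlgHom.card, L0.2.1]
    rw [← hemb, ← Finset.card_univ, ← Finset.card_map (Function.Embedding.subtype _)]
    refine le_trans (Finset.card_le_card ?_)
      (Finset.card_image_le (f := fun φ : (L0 : IntermediateField K Kbar) →ₐ[K] Kbar => φ.fieldRange))
    intro L' hL'
    obtain ⟨L, hL, rfl⟩ := Finset.mem_map.1 hL'
    have hfL : f L = f L0 := (Finset.mem_filter.1 hL).2
    have := hfdim L
    have htr : ∀ e : Fin r → ℕ, (∀ i, e i ≤ 2 * d + 1) →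
        Algebra.trace K (L0 : IntermediateField K Kbar) (∏ i, x L0 i ^ e i) =
        Algebra.trace K (L : IntermediateField K Kbar) (∏ i, x L i ^ e i) := by
      intro e he
      exact (congrFun hfL (fun i => ⟨e i, Nat.lt_succ_of_le (he i)⟩)).symm
    have hz : ∀ i, σ ⟨0, hn0⟩ i = 0 := by
      intro i
      have h1 := hs ⟨0, hn0⟩
      simp only at h1
      rw [Finset.sum_eq_zero_iff] at h1
      have h2 := h1 i (Finset.mem_univ _)
      simpa using h2
    obtain ⟨φ⟩ := iso_aux (K := K) L0.2.1 L.2.1 σ ⟨0, hn0⟩ hz (x L0) (x L) (hli L0) (hli L)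
      (by
        intro t s
        simp_rw [← Finset.prod_mul_distrib, ← pow_add]
        refine htr _ fun i => ?_
        have := hσ t i
        have := hσ s i
        omega)
      (by
        intro j t s
        have h1 : ∀ (M : Type) [Field M] (z : Fin r → M),
            z j * (∏ i, z i ^ σ t i) * ∏ i, z i ^ σ s i =
              ∏ i, z i ^ ((if i = j then 1 else 0) + σ t i + σ s i) := by
          intro M _ z
          simp_rw [pow_add, Finset.prod_mul_distrib]
          congr 2
          simp [Finset.prod_ite_eq]
        rw [h1, h1]
        refine htr _ fun i => ?_
        have := hσ t i
        have := hσ s i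
        split_ifs <;> omega)
    rw [Finset.mem_image]
    refine ⟨(L : IntermediateField K Kbar).val.comp φ.toAlgHom, Finset.mem_univ _, ?_⟩
    ext z
    constructor
    · rintro ⟨y, rfl⟩
      exact (φ y).2
    · intro hz
      exact ⟨φ.symm ⟨z, hz⟩, by simp⟩)
  have hcard2 : (Finset.univ.image f).card ≤ hSf.toFinset.card ^ q := by
    refine (Finset.card_le_card (t := Fintype.piFinset (fun _ => hSf.toFinset)) ?_).trans ?_
    · intro y hy
      obtain ⟨L, _, rfl⟩ := Finset.mem_image.1 hy
      exact hfS L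
    · rw [Fintype.card_piFinset]
      simp [hq]
  rw [Nat.card_eq_fintype_card, ← Finset.card_univ]
  have hS3 : (hSf.toFinset.card : ℝ) ≤ (3 * Z) ^ k := by
    refine (hSfin _ fun a ha => by simpa using ha).trans ?_
    gcongr
    linarith
  calc ((Finset.univ : Finset F).card : ℝ) ≤ n * (hSf.toFinset.card : ℝ) ^ q := by
        exact_mod_cast hcard.trans (Nat.mul_le_mul_left _ hcard2)
    _ ≤ n * ((3 * Z) ^ k) ^ q := by gcongr
    _ = _ := by
      rw [← pow_mul, hZ, ← mul_assoc 3, mul_pow, mul_assoc, ← Real.rpow_natCast (X ^ _),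
        ← Real.rpow_mul (by positivity)]
      congr 3
      have : (k : ℝ) ≠ 0 := by positivity
      have : (n : ℝ) ≠ 0 := by positivity
      push_cast
      field_simp

/-- for every `ε > 0` there is `C_ε > 0` such that
`limsup_{X→∞} log N_{K,n}(X) / log X ≤ C_ε · n^ε` for all `n > 2` and all number
fields `K`. -/
theorem limsup_log_count_extensions_le (ε : ℝ) (hε : 0 < ε) :
    ∃ C : ℝ, 0 < C ∧
      ∀ n : ℕ, 2 < n →
        ∀ (K : Type) [Field K] [NumberField K]
          (Kbar : Type) [Field Kbar] [Algebra K Kbar] [IsAlgClosure K Kbar],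
          Filter.limsup
            (fun X : ℝ =>
              Real.log (Nat.card {L : IntermediateField K Kbar |
                finrank K L = n ∧ (relDiscNorm K L : ℝ) < X}) / Real.log X)
            Filter.atTop ≤ C * (n : ℝ) ^ ε := by
  obtain ⟨r, hr⟩ := exists_nat_gt (1 / ε)
  have hr0 : 0 < r := by
    have : (0 : ℝ) < r := lt_trans (by positivity) hr
    exact_mod_cast this
  have hrε : 1 / (r : ℝ) ≤ ε := by
    rw [div_le_iff₀ (by positivity)]
    rw [div_lt_iff₀ hε] at hr
    linarith
  refine ⟨8 * r * 4 ^ r + 1, by positivity, ?_⟩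
  intro n hn K _ _ Kbar _ _ _
  have hn1 : (1 : ℝ) ≤ n := by exact_mod_cast (by omega : 1 ≤ n)
  set y : ℝ := (n : ℝ) ^ (1 / (r : ℝ)) with hy
  have hy1 : 1 ≤ y := Real.one_le_rpow hn1 (by positivity)
  have hyr : y ^ r = n := by
    rw [hy, ← Real.rpow_natCast, ← Real.rpow_mul (by positivity), one_div,
      inv_mul_cancel₀ (by positivity), Real.rpow_one]
  have hyε : y ≤ (n : ℝ) ^ ε := Real.rpow_le_rpow_of_exponent_le hn1 hrε
  set d := ⌊y⌋₊ with hd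
  have hdy : (d : ℝ) ≤ y := Nat.floor_le (by linarith)
  have hdn : n ≤ (d + 1) ^ r := by
    have : (n : ℝ) ≤ ((d + 1 : ℕ) : ℝ) ^ r := by
      rw [← hyr]
      gcongr
      push_cast
      exact (Nat.lt_floor_add_one y).le
    exact_mod_cast this
  obtain ⟨A, hA, hcount⟩ := count_aux K Kbar (by omega : 0 < n) hdn
  set E : ℝ := 2 * ((r * (2 * d + 1) : ℕ) : ℝ) * (((2 * d + 2) ^ r : ℕ) : ℝ) / n with hE
  have hE1 : E ≤ 8 * r * 4 ^ r * (n : ℝ) ^ ε := by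
    have h1 : (((2 * d + 2) ^ r : ℕ) : ℝ) ≤ 4 ^ r * n := by
      push_cast
      rw [← hyr, ← mul_pow]
      gcongr
      linarith
    have h2 : ((r * (2 * d + 1) : ℕ) : ℝ) ≤ r * (4 * y) := by
      push_cast
      gcongr
      linarith
    rw [hE, div_le_iff₀ (by positivity)]
    calc _ ≤ 2 * (r * (4 * y)) * (4 ^ r * n) := by gcongr
      _ ≤ 2 * (r * (4 * (n : ℝ) ^ ε)) * (4 ^ r * n) := by gcongr
      _ = _ := by ring
  have hnε : 1 ≤ (n : ℝ) ^ ε := hy1.trans hyε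
  refine Filter.limsup_le_of_le ?_ ?_
  · refine Filter.IsCoboundedUnder.of_frequently_ge (a := 0) (Filter.Eventually.frequently ?_)
    filter_upwards [Filter.eventually_ge_atTop 1] with X hX
    exact div_nonneg (Real.log_natCast_nonneg _) (Real.log_nonneg hX)
  · filter_upwards [Filter.eventually_gt_atTop 1, Filter.eventually_ge_atTop A] with X hX hXA
    have hlog : 0 < Real.log X := Real.log_pos hX
    rw [div_le_iff₀ hlog]
    have h1 := hcount X hX.le
    rcases Nat.eq_zero_or_pos (Nat.card {L : IntermediateField K Kbar |
                finrank K L = n ∧ (relDiscNorm K L : ℝ) < X}) with h0 | h0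
    · rw [h0]
      simp only [Nat.cast_zero, Real.log_zero]
      positivity
    · calc _ ≤ Real.log (A * X ^ E) := Real.log_le_log (by exact_mod_cast h0) h1
        _ = Real.log A + E * Real.log X := by
          rw [Real.log_mul (by positivity) (by positivity), Real.log_rpow (by positivity)]
        _ ≤ Real.log X + E * Real.log X := by
          gcongr
        _ = (E + 1) * Real.log X := by ring
        _ ≤ _ := by
          gcongr
          linarith
end

section
/- Let n ≥ 3 be an integer. There exists a constant c_n > 0, depending only on n, such that every number field L of degree n over ℚ contains an element x ∈ 𝓞_L with ℚ(x) = L and house(x) ≤ c_n · D_L^{1/(2⌊(n−1)/2⌋)}, where D_L = |disc(L/ℚ)|. In particular s(L) ≤ c_n · D_L^{1/(2⌊(n−1)/2⌋)}, where s(L) = inf{house(x) : x ∈ 𝓞_L, ℚ(x) = L}. -/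
open NumberField Module

/-- Minkowski's theorem for the body `‖P_V x‖ < a⁻¹`, `‖P_{V^⊥} x‖ < b⁻¹`. -/
theorem minkowski_aux {E : Type*} [NormedAddCommGroup E] [InnerProductSpace ℝ E]
    [FiniteDimensional ℝ E] [MeasurableSpace E] [BorelSpace E] [Nontrivial E]
    (Λ : Submodule ℤ E) [DiscreteTopology Λ] [IsZLattice ℝ Λ] (V : Submodule ℝ E)
    (a b : ℝ) (ha : 0 < a) (hb : 0 < b)
    (h : ZLattice.covolume Λ * 2 ^ finrank ℝ E * (a ^ finrank ℝ V * b ^ (finrank ℝ E - finrank ℝ V))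
      < √Real.pi ^ finrank ℝ E / Real.Gamma (finrank ℝ E / 2 + 1)) :
    ∃ x ∈ Λ, x ≠ 0 ∧ a * ‖V.starProjection x‖ < 1 ∧ b * ‖x - V.starProjection x‖ < 1 := by
  classical
  set P : E →ₗ[ℝ] E := (V.starProjection : E →L[ℝ] E).toLinearMap with hP
  have hPV : ∀ x ∈ V, P x = x := fun x hx => Submodule.starProjection_eq_self_iff.2 hx
  have hPm : ∀ x, P x ∈ V := fun x => Submodule.starProjection_apply_mem V x
  set T : E →ₗ[ℝ] E := a • P + b • (LinearMap.id - P) with hT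
  have hTx : ∀ x, T x = a • P x + b • (x - P x) := fun x => by simp [hT]
  have hTV : V ≤ V.comap T := by
    intro x hx
    simp only [Submodule.mem_comap, hTx, hPV x hx, sub_self, smul_zero, add_zero]
    exact V.smul_mem _ hx
  have hdet : T.det = a ^ finrank ℝ V * b ^ (finrank ℝ E - finrank ℝ V) := by
    rw [LinearMap.det_eq_det_mul_det V T hTV]
    have h1 : T.restrict hTV = a • LinearMap.id := by
      ext x
      simp [LinearMap.restrict_apply, hTx, hPV x x.2]
    have h2 : V.mapQ V T hTV = b • LinearMap.id := by
      apply Submodule.linearMap_qext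
      ext x
      simp only [LinearMap.comp_apply, Submodule.mkQ_apply, Submodule.mapQ_apply,
        LinearMap.smul_apply, LinearMap.id_apply]
      rw [← Submodule.Quotient.mk_smul, Submodule.Quotient.eq, hTx]
      have : a • P x + b • (x - P x) - b • x = (a - b) • P x := by module
      rw [this]
      exact V.smul_mem _ (hPm x)
    rw [h1, h2, LinearMap.det_smul, LinearMap.det_smul, LinearMap.det_id, LinearMap.det_id,
      Submodule.finrank_quotient, mul_one, mul_one]
  have hd : 0 < T.det := by rw [hdet]; positivity
  set F := ZSpan.fundamentalDomain ((ZLattice.module_free ℝ Λ).chooseBasis.ofZLatticeBasis ℝ Λ)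
    with hF
  have fund : MeasureTheory.IsAddFundamentalDomain Λ F :=
    ZLattice.isAddFundamentalDomain _ _
  have hcov := ZLattice.covolume_eq_measure_fundamentalDomain Λ MeasureTheory.volume fund
  have hFfin : MeasureTheory.volume F ≠ ⊤ :=
    (ZSpan.fundamentalDomain_isBounded _).measure_lt_top.ne
  have hvol : MeasureTheory.volume F * 2 ^ finrank ℝ E <
      MeasureTheory.volume (T ⁻¹' Metric.ball 0 1) := by
    rw [MeasureTheory.Measure.addHaar_preimage_linearMap _ hd.ne', InnerProductSpace.volume_ball,
      ← ENNReal.ofReal_toReal hFfin]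
    rw [MeasureTheory.measureReal_def] at hcov
    rw [← hcov, ENNReal.ofReal_one, one_pow, one_mul, show (2 : ENNReal) = ENNReal.ofReal 2 by simp,
      ← ENNReal.ofReal_pow (by norm_num), ← ENNReal.ofReal_mul (by rw [hcov]; positivity),
      ← ENNReal.ofReal_mul (by positivity)]
    apply (ENNReal.ofReal_lt_ofReal_iff_of_nonneg (by rw [hcov]; positivity)).2
    rw [abs_of_pos (inv_pos.2 hd), inv_mul_eq_div, lt_div_iff₀ hd, hdet]
    exact h
  have : Countable Λ := inferInstance
  obtain ⟨x, hx0, hx⟩ :=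
    MeasureTheory.exists_ne_zero_mem_lattice_of_measure_mul_two_pow_lt_measure
      (L := Λ.toAddSubgroup) (μ := MeasureTheory.volume) (s := T ⁻¹' Metric.ball 0 1)
      fund (by intro x; simp) ((convex_ball 0 1).linear_preimage T) hvol
  refine ⟨x, x.2, by simpa using hx0, ?_, ?_⟩
  · have h1 : V.starProjection (T x) = a • V.starProjection (x : E) := by
      change P (T x) = a • P x
      rw [hTx, map_add, map_smul, map_smul, map_sub, hPV _ (hPm _), sub_self, smul_zero, add_zero]
    have h2 := V.norm_starProjection_apply_le (T x)
    rw [h1, norm_smul, Real.norm_of_nonneg ha.le] at h2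
    exact h2.trans_lt (by simpa using hx)
  · have h1 : Vᗮ.starProjection (T x) = b • ((x : E) - V.starProjection (x : E)) := by
      rw [Submodule.starProjection_orthogonal_val]
      change T x - P (T x) = b • ((x : E) - P x)
      have : P (T x) = a • P x := by
        rw [hTx, map_add, map_smul, map_smul, map_sub, hPV _ (hPm _), sub_self, smul_zero, add_zero]
      rw [this, hTx]; abel
    have h2 := Vᗮ.norm_starProjection_apply_le (T x)
    rw [h1, norm_smul, Real.norm_of_nonneg hb.le] at h2
    exact h2.trans_lt (by simpa using hx)

/-- A generating set of a number field yields a generator which is a combination of at most `n`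
elements with bounded coefficients. -/
theorem generator_aux {L : Type*} [Field L] [NumberField L] (n : ℕ) (hn : finrank ℚ L = n)
    (A : Set L) (hA : ∀ K : IntermediateField ℚ L, A ⊆ K → K = ⊤) :
    ∃ (r : ℕ) (b : Fin r → L) (t : ℕ), r ≤ n ∧ t ≤ n * n * n ∧ (∀ i, b i ∈ A) ∧
      IntermediateField.adjoin ℚ {∑ i : Fin r, ((t ^ (i : ℕ) : ℕ) : L) * b i} = ⊤ := by
  classical
  obtain ⟨b, hbA, hbspan, -⟩ := Submodule.exists_fun_fin_finrank_span_eq ℚ A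
  have hrn : finrank ℚ (Submodule.span ℚ A) ≤ n := hn ▸ Submodule.finrank_le _
  revert b
  generalize finrank ℚ (Submodule.span ℚ A) = r at hrn
  intro b hbA hbspan
  have hsep : ∀ σ τ : L →ₐ[ℚ] ℂ, σ ≠ τ → ∃ i, σ (b i) ≠ τ (b i) := by
    intro σ τ hne
    by_contra! hcon
    apply hne
    have h1 : A ⊆ (AlgHom.equalizer σ τ : Set L) := by
      have h2 : Submodule.span ℚ (Set.range b) ≤ Subalgebra.toSubmodule (AlgHom.equalizer σ τ) := by
        rw [Submodule.span_le]
        rintro _ ⟨i, rfl⟩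
        exact hcon i
      rw [hbspan] at h2
      exact fun x hx => h2 (Submodule.subset_span hx)
    let K : IntermediateField ℚ L :=
      { AlgHom.equalizer σ τ with
        inv_mem' := fun x hx => by
          have hx' : σ x = τ x := hx
          change σ x⁻¹ = τ x⁻¹
          rw [map_inv₀, map_inv₀, hx'] }
    have hK := hA K h1
    ext x
    have : x ∈ K := by rw [hK]; trivial
    exact this
  let p : (L →ₐ[ℚ] ℂ) × (L →ₐ[ℚ] ℂ) → Polynomial ℂ := fun q =>
    ∑ i : Fin r, Polynomial.C (q.1 (b i) - q.2 (b i)) * Polynomial.X ^ (i : ℕ)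
  have hp0 : ∀ q : (L →ₐ[ℚ] ℂ) × (L →ₐ[ℚ] ℂ), q.1 ≠ q.2 → p q ≠ 0 := by
    intro q hq h0
    obtain ⟨i, hi⟩ := hsep _ _ hq
    apply hi
    have := congrArg (fun f => Polynomial.coeff f (i : ℕ)) h0
    simp only [p, Polynomial.finsetSum_coeff, Polynomial.coeff_C_mul, Polynomial.coeff_X_pow,
      Polynomial.coeff_zero] at this
    rw [Finset.sum_eq_single i] at this
    · simpa [sub_eq_zero] using this
    · intro j _ hj
      simp [Fin.val_inj, hj.symm]
    · simp
  have hpdeg : ∀ q, (p q).natDegree ≤ n := by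
    intro q
    apply Polynomial.natDegree_sum_le_of_forall_le
    intro i _
    exact (Polynomial.natDegree_C_mul_X_pow_le _ _).trans (i.2.le.trans hrn)
  let S : Finset ((L →ₐ[ℚ] ℂ) × (L →ₐ[ℚ] ℂ)) := Finset.univ.filter fun q => q.1 ≠ q.2
  have hcard : Fintype.card (L →ₐ[ℚ] ℂ) = n := by rw [AlgHom.card, hn]
  have hS : S.card ≤ n * n := by
    refine (Finset.card_filter_le _ _).trans ?_
    rw [Finset.card_univ, Fintype.card_prod, hcard]
  have hQ0 : ∏ q ∈ S, p q ≠ 0 := by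
    rw [Finset.prod_ne_zero_iff]
    intro q hq
    exact hp0 q (by simpa [S] using hq)
  have hQdeg : (∏ q ∈ S, p q).natDegree ≤ n * n * n := by
    refine (Polynomial.natDegree_prod_le _ _).trans ?_
    refine (Finset.sum_le_card_nsmul _ _ n fun q _ => hpdeg q).trans ?_
    rw [smul_eq_mul]
    gcongr
  obtain ⟨t, ht, hne⟩ : ∃ t ≤ n * n * n, (∏ q ∈ S, p q).eval (t : ℂ) ≠ 0 := by
    by_contra! hcon
    apply hQ0
    refine Polynomial.eq_zero_of_natDegree_lt_card_of_eval_eq_zero _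
      (f := fun i : Fin (n * n * n + 1) => ((i : ℕ) : ℂ)) ?_ ?_ ?_
    · intro i j hij
      have hij' : ((i : ℕ) : ℂ) = ((j : ℕ) : ℂ) := hij
      exact Fin.ext (by exact_mod_cast hij')
    · intro i
      exact hcon i (by omega)
    · rw [Fintype.card_fin]; omega
  refine ⟨r, b, t, hrn, ht, hbA, ?_⟩
  rw [Field.primitive_element_iff_algHom_eq_of_eval' ℚ ℂ (fun x => IsAlgClosed.splits _)]
  intro σ τ hst
  by_contra hne'
  rw [Polynomial.eval_prod, Finset.prod_ne_zero_iff] at hne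
  apply hne (σ, τ) (by simp [S, hne'])
  simp only [p, Polynomial.eval_finsetSum, Polynomial.eval_mul, Polynomial.eval_C,
    Polynomial.eval_pow, Polynomial.eval_X]
  simp only [map_sum, map_mul, map_natCast] at hst
  rw [← sub_eq_zero, ← Finset.sum_sub_distrib] at hst
  rw [← hst]
  refine Finset.sum_congr rfl fun i _ => ?_
  push_cast
  ring

/-- The embedding of a number field in its Euclidean mixed space. -/
noncomputable def eucEmb (L : Type*) [Field L] [NumberField L] (x : L) :
    mixedEmbedding.euclidean.mixedSpace L :=
  (mixedEmbedding.euclidean.toMixed L).symm (mixedEmbedding L x)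

theorem eucEmb_add {L : Type*} [Field L] [NumberField L] (x y : L) :
    eucEmb L (x + y) = eucEmb L x + eucEmb L y := by
  simp [eucEmb]

theorem eucEmb_smul {L : Type*} [Field L] [NumberField L] (q : ℚ) (x : L) :
    eucEmb L (q • x) = (q : ℝ) • eucEmb L x := by
  rw [eucEmb, eucEmb, ← map_smul]
  congr 1
  rw [Algebra.smul_def, map_mul]
  ext w <;> simp

open scoped Classical in
theorem house_le_norm_eucEmb {L : Type*} [Field L] [NumberField L] (x : L) :
    house x ≤ ‖eucEmb L x‖ := by
  rw [house, pi_norm_le_iff_of_nonneg (norm_nonneg _)]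
  intro φ
  rw [canonicalEmbedding.apply_at, ← InfinitePlace.apply]
  set w := InfinitePlace.mk φ
  rw [← mixedEmbedding.normAtPlace_apply]
  have hxe : mixedEmbedding L x = mixedEmbedding.euclidean.toMixed L (eucEmb L x) := by
    simp [eucEmb]
  rw [hxe]
  generalize eucEmb L x = y
  have hfst : ‖y.fst‖ ≤ ‖y‖ := by
    rw [WithLp.prod_norm_eq_of_L2]
    exact Real.le_sqrt_of_sq_le (by nlinarith [sq_nonneg ‖y.snd‖])
  have hsnd : ‖y.snd‖ ≤ ‖y‖ := by
    rw [WithLp.prod_norm_eq_of_L2]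
    exact Real.le_sqrt_of_sq_le (by nlinarith [sq_nonneg ‖y.fst‖])
  rcases w.isReal_or_isComplex with hw | hw
  · rw [mixedEmbedding.normAtPlace_apply_of_isReal hw]
    exact (PiLp.norm_apply_le y.fst ⟨w, hw⟩).trans hfst
  · rw [mixedEmbedding.normAtPlace_apply_of_isComplex hw]
    exact (PiLp.norm_apply_le y.snd ⟨w, hw⟩).trans hsnd

theorem finrank_span_eucEmb_le {L : Type*} [Field L] [NumberField L]
    (K : IntermediateField ℚ L) :
    finrank ℝ (Submodule.span ℝ (eucEmb L '' (K : Set L))) ≤ finrank ℚ K := by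
  let e := finBasis ℚ K
  have h : Submodule.span ℝ (eucEmb L '' (K : Set L)) ≤
      Submodule.span ℝ (Set.range fun i => eucEmb L (e i : L)) := by
    rw [Submodule.span_le]
    rintro _ ⟨x, hx, rfl⟩
    have h1 := e.sum_repr ⟨x, hx⟩
    have h2 : x = ∑ i, (e.repr ⟨x, hx⟩ i) • (e i : L) := by
      have := congrArg K.val h1
      rw [map_sum] at this
      exact this.symm
    let f : L →+ mixedEmbedding.euclidean.mixedSpace L :=
      AddMonoidHom.mk' (eucEmb L) eucEmb_add
    have h3 : eucEmb L x = ∑ i, ((e.repr ⟨x, hx⟩ i : ℚ) : ℝ) • eucEmb L (e i : L) := by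
      change f x = _
      conv_lhs => rw [h2]
      rw [map_sum]
      exact Finset.sum_congr rfl fun i _ => eucEmb_smul _ _
    rw [h3]
    exact Submodule.sum_mem _ fun i _ => Submodule.smul_mem _ _ (Submodule.subset_span ⟨i, rfl⟩)
  refine (Submodule.finrank_mono h).trans ?_
  refine (finrank_range_le_card _).trans ?_
  simp

theorem mem_lattice_aux {L : Type*} [Field L] [NumberField L]
    (y : mixedEmbedding.euclidean.mixedSpace L)
    (hy : y ∈ mixedEmbedding.euclidean.integerLattice L) :
    ∃ x : L, IsIntegral ℤ x ∧ eucEmb L x = y := by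
  obtain ⟨x, hx⟩ : mixedEmbedding.euclidean.toMixed L y ∈ mixedEmbedding.integerLattice L := hy
  refine ⟨x, x.2, ?_⟩
  rw [eucEmb, ContinuousLinearEquiv.symm_apply_eq]
  exact hx

open scoped Classical in
theorem covolume_le_aux (L : Type*) [Field L] [NumberField L] :
    ZLattice.covolume (mixedEmbedding.euclidean.integerLattice L) ≤
      √((NumberField.discr L).natAbs : ℝ) := by
  have h := ZLattice.covolume_comap (mixedEmbedding.integerLattice L) MeasureTheory.volume
    MeasureTheory.volume (mixedEmbedding.euclidean.volumePreserving_toMixed L)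
  have h' : ZLattice.covolume (mixedEmbedding.euclidean.integerLattice L) =
      ZLattice.covolume (mixedEmbedding.integerLattice L) := h
  rw [h', mixedEmbedding.covolume_integerLattice, Nat.cast_natAbs]
  push_cast
  exact mul_le_of_le_one_left (Real.sqrt_nonneg _) (pow_le_one₀ (by norm_num) (by norm_num))


open scoped Classical in
theorem generates_aux {L : Type*} [Field L] [NumberField L] (n k : ℕ) (hn : finrank ℚ L = n)
    (hk : 1 ≤ k) (hkn : 2 * k ≤ n) (C : ℝ) (hC1 : 1 ≤ C)
    (hC : 4 ^ n < (√Real.pi ^ n / Real.Gamma (n / 2 + 1)) * C)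
    (K : IntermediateField ℚ L)
    (hK : {x : L | IsIntegral ℤ x ∧ ‖eucEmb L x‖ <
      C * ((NumberField.discr L).natAbs : ℝ) ^ ((1 : ℝ) / (2 * (k : ℝ)))} ⊆ K) : K = ⊤ := by
  by_contra hne
  set D : ℝ := ((NumberField.discr L).natAbs : ℝ) with hD
  have hD1 : 1 ≤ D := by
    rw [hD]
    exact_mod_cast Nat.one_le_iff_ne_zero.2 (Int.natAbs_ne_zero.2 (discr_ne_zero L))
  set B : ℝ := C * D ^ ((1 : ℝ) / (2 * (k : ℝ))) with hB
  have hkpos : (0 : ℝ) < k := by exact_mod_cast hk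
  have hDk : 1 ≤ D ^ ((1 : ℝ) / (2 * (k : ℝ))) := Real.one_le_rpow hD1 (by positivity)
  have hB1 : 1 ≤ B := one_le_mul_of_one_le_of_one_le hC1 hDk
  have hB0 : 0 < B := by linarith
  have hBk : C * √D ≤ B ^ k := by
    have h1 : (D ^ ((1 : ℝ) / (2 * (k : ℝ)))) ^ k = √D := by
      rw [← Real.rpow_natCast, ← Real.rpow_mul (by linarith), Real.sqrt_eq_rpow]
      congr 1
      field_simp
    rw [hB, mul_pow, h1]
    gcongr
    exact le_self_pow₀ hC1 (by omega)
  set V := Submodule.span ℝ (eucEmb L '' (K : Set L)) with hV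
  have hdK : finrank ℚ K * 2 ≤ n := by
    rw [← hn, ← Module.finrank_mul_finrank ℚ K L]
    have h1 : finrank K L ≠ 1 := fun h => hne (IntermediateField.finrank_eq_one_iff_eq_top.1 h)
    have h2 : 0 < finrank K L := finrank_pos
    gcongr
    omega
  have hdV : finrank ℝ V ≤ finrank ℚ K := finrank_span_eucEmb_le K
  have hE : finrank ℝ (mixedEmbedding.euclidean.mixedSpace L) = n := by
    rw [mixedEmbedding.euclidean.finrank, hn]
  have hv : 0 < √Real.pi ^ n / Real.Gamma (n / 2 + 1) := by
    have : 0 < Real.Gamma ((n : ℝ) / 2 + 1) := Real.Gamma_pos_of_pos (by positivity)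
    have := Real.pi_pos
    positivity
  have hs : 0 < √D := Real.sqrt_pos.2 (by linarith)
  obtain ⟨y, hyΛ, hy0, hy1, hy2⟩ := minkowski_aux (mixedEmbedding.euclidean.integerLattice L) V
    2 (2 / B) (by norm_num) (by positivity) (by
      rw [hE, div_pow, mul_div_assoc', ← pow_add, Nat.add_sub_cancel' (by omega), mul_div_assoc',
        div_lt_iff₀ (by positivity)]
      calc _ ≤ √D * 2 ^ n * 2 ^ n := by
            gcongr
            exact covolume_le_aux L
        _ = 4 ^ n * √D := by rw [mul_assoc, ← mul_pow]; norm_num [mul_comm]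
        _ < (√Real.pi ^ n / Real.Gamma (n / 2 + 1)) * C * √D := by gcongr
        _ = (√Real.pi ^ n / Real.Gamma (n / 2 + 1)) * (C * √D) := by ring
        _ ≤ (√Real.pi ^ n / Real.Gamma (n / 2 + 1)) * B ^ k := by gcongr
        _ ≤ _ := by
            gcongr
            omega)
  obtain ⟨x, hxi, rfl⟩ := mem_lattice_aux y hyΛ
  have hx0 : x ≠ 0 := by
    rintro rfl
    apply hy0
    simp [eucEmb]
  have hy2' : ‖eucEmb L x - V.starProjection (eucEmb L x)‖ < B / 2 := by
    rw [div_mul_eq_mul_div, div_lt_one hB0] at hy2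
    linarith
  have hnorm : ‖eucEmb L x‖ < B := by
    have := norm_add_le (V.starProjection (eucEmb L x))
      (eucEmb L x - V.starProjection (eucEmb L x))
    rw [add_sub_cancel] at this
    linarith
  have hxV : eucEmb L x ∈ V := Submodule.subset_span ⟨x, hK ⟨hxi, hnorm⟩, rfl⟩
  rw [Submodule.starProjection_eq_self_iff.2 hxV] at hy1
  have h1 := one_le_house_of_isIntegral hxi hx0
  have h2 := house_le_norm_eucEmb x
  linarith

/-- every number field `L` of degree `n ≥ 3` contains an integral generator of
house at most `c_n · D_L^{1/(2⌊(n-1)/2⌋)}`; in particular `s(L)` is at most this bound. -/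
theorem exists_integral_generator_small_house (n : ℕ) (hn : 3 ≤ n) :
    ∃ c : ℝ, 0 < c ∧
      ∀ (L : Type) [Field L] [NumberField L], finrank ℚ L = n →
        (∃ x : L, IsIntegral ℤ x ∧ IntermediateField.adjoin ℚ {x} = ⊤ ∧
          NumberField.house x ≤
            c * ((NumberField.discr L).natAbs : ℝ) ^
              ((1 : ℝ) / (2 * (((n - 1) / 2 : ℕ) : ℝ)))) ∧
        sInf {h : ℝ | ∃ x : L, IsIntegral ℤ x ∧ IntermediateField.adjoin ℚ {x} = ⊤ ∧
            NumberField.house x = h} ≤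
          c * ((NumberField.discr L).natAbs : ℝ) ^
            ((1 : ℝ) / (2 * (((n - 1) / 2 : ℕ) : ℝ))) := by
  have hv : 0 < √Real.pi ^ n / Real.Gamma (n / 2 + 1) := by
    have : 0 < Real.Gamma ((n : ℝ) / 2 + 1) := Real.Gamma_pos_of_pos (by positivity)
    have := Real.pi_pos
    positivity
  set v := √Real.pi ^ n / Real.Gamma (n / 2 + 1) with hvdef
  set C : ℝ := 4 ^ n / v + 1 with hC
  have hC1 : 1 ≤ C := by
    have : 0 < 4 ^ n / v := by positivity
    linarith
  have hC2 : 4 ^ n < v * C := by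
    rw [hC, mul_add, mul_div_cancel₀ _ hv.ne']
    linarith
  have hN : 1 ≤ n * n * n := Nat.one_le_iff_ne_zero.2 (by positivity)
  set M : ℝ := ((n * n * n : ℕ) : ℝ) ^ n with hM
  have hM0 : 0 < M := by
    have : (0 : ℝ) < ((n * n * n : ℕ) : ℝ) := by exact_mod_cast hN
    positivity
  have hn0 : (0 : ℝ) < n := by exact_mod_cast (by omega : 0 < n)
  refine ⟨n * M * C, by positivity, ?_⟩
  intro L _ _ hL
  have main : ∃ x : L, IsIntegral ℤ x ∧ IntermediateField.adjoin ℚ {x} = ⊤ ∧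
      NumberField.house x ≤ n * M * C * ((NumberField.discr L).natAbs : ℝ) ^
              ((1 : ℝ) / (2 * (((n - 1) / 2 : ℕ) : ℝ))) := by
    obtain ⟨r, b, t, hr, ht, hb, hgen⟩ := generator_aux n hL _
      (generates_aux (L := L) n ((n - 1) / 2) hL (by omega) (by omega) C hC1 hC2)
    refine ⟨_, ?_, hgen, ?_⟩
    · refine IsIntegral.sum _ fun i _ => IsIntegral.mul ?_ (hb i).1
      exact_mod_cast isIntegral_algebraMap (R := ℤ) (A := L) (x := ((t ^ (i : ℕ) : ℕ) : ℤ))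
    · set B : ℝ := C * ((NumberField.discr L).natAbs : ℝ) ^
              ((1 : ℝ) / (2 * (((n - 1) / 2 : ℕ) : ℝ))) with hB
      have hB0 : 0 ≤ B := by positivity
      calc _ ≤ ∑ i : Fin r, house (((t ^ (i : ℕ) : ℕ) : L) * b i) := house_sum_le_sum_house _ _
        _ ≤ ∑ i : Fin r, M * B := by
            refine Finset.sum_le_sum fun i _ => ?_
            rw [house_nat_mul]
            refine mul_le_mul ?_ ((house_le_norm_eucEmb _).trans (hb i).2.le) (house_nonneg _) hM0.le
            rw [hM]
            have h1 : t ^ (i : ℕ) ≤ (n * n * n) ^ n :=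
              (Nat.pow_le_pow_left ht _).trans (Nat.pow_le_pow_right hN (i.2.le.trans hr))
            exact_mod_cast h1
        _ = r * (M * B) := by simp
        _ ≤ n * (M * B) := by gcongr
        _ = _ := by rw [hB]; ring
  refine ⟨main, ?_⟩
  obtain ⟨x, hx1, hx2, hx3⟩ := main
  refine le_trans (csInf_le ?_ ?_) hx3
  swap
  · exact ⟨x, hx1, hx2, rfl⟩
  refine ⟨0, ?_⟩
  rintro _ ⟨z, -, -, rfl⟩
  exact house_nonneg z
end
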